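/- Let Γ be a finite simplicial graph such that no equivalence class of vertices under ∼ has exactly 2 elements. Then for every m ≥ 0, SIA_Γ(m) equals the normal closure in SAut⁰(A_Γ) of the union of IA_Γ and the set of m-th powers of all transvections. -/

import Mathlib

open SimpleGraph

namespace RaagPaper

variable {V : Type} [Fintype V] [DecidableEq V]

/-- The defining relations of the right-angled Artin group of a graph `Γ`. -/
def Rels (Γ : SimpleGraph V) : Set (FreeGroup V) :=
  {r | ∃ u v : V, Γ.Adj u v ∧
    r = FreeGroup.of u * FreeGroup.of v * (FreeGroup.of u)⁻¹ * (FreeGroup.of v)⁻¹}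

/-- The right-angled Artin group of `Γ`. -/
abbrev Raag (Γ : SimpleGraph V) := PresentedGroup (Rels Γ)

/-- The generator of `Raag Γ` corresponding to the vertex `v`. -/
def gen (Γ : SimpleGraph V) (v : V) : Raag Γ := PresentedGroup.of v

/-- The link of a vertex. -/
def lk (Γ : SimpleGraph V) (v : V) : Set V := Γ.neighborSet v

/-- The star of a vertex. -/
def st (Γ : SimpleGraph V) (v : V) : Set V := insert v (Γ.neighborSet v)

/-- The partial preorder `v ≤ w ↔ lk v ⊆ st w` on vertices. -/
def Le (Γ : SimpleGraph V) (v w : V) : Prop := lk Γ v ⊆ st Γ w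

/-- The equivalence `v ∼ w`. -/
def Sim (Γ : SimpleGraph V) (v w : V) : Prop := Le Γ v w ∧ Le Γ w v

/-- The equivalence class of a vertex under `∼`. -/
def simClass (Γ : SimpleGraph V) (v : V) : Set V := {u | Sim Γ u v}

/-- Property (B1): any two distinct non-adjacent vertices are `∼`-equivalent. -/
def B1 (Γ : SimpleGraph V) : Prop :=
  ∀ u v : V, u ≠ v → ¬ Γ.Adj u v → Sim Γ u v

/-- Property (B2). -/
def B2 (Γ : SimpleGraph V) : Prop :=
  ∀ v w : V, v ≠ w → Le Γ v w → ∃ u : V, u ≠ v ∧ u ≠ w ∧ Le Γ v u ∧ Le Γ u w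

/-- `α` is the transvection `t_{vw}` for some `v ≤ w`. -/
def IsTransvection (Γ : SimpleGraph V) (α : MulAut (Raag Γ)) : Prop :=
  ∃ v w : V, v ≠ w ∧ Le Γ v w ∧ α (gen Γ v) = gen Γ v * gen Γ w ∧
    ∀ z : V, z ≠ v → α (gen Γ z) = gen Γ z

/-- `Y` is (the vertex set of) a connected component of the subgraph of `Γ` induced on `S`. -/
def IsCompOf (Γ : SimpleGraph V) (S : Set V) (Y : Set V) : Prop :=
  ∃ C : (Γ.induce S).ConnectedComponent, Y = Subtype.val '' C.supp

/-- `α` is a partial conjugation `c_{v,Y}`. -/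
def IsPartialConj (Γ : SimpleGraph V) (α : MulAut (Raag Γ)) : Prop :=
  ∃ (v : V) (Y : Set V), IsCompOf Γ (st Γ v)ᶜ Y ∧
    (∀ y ∈ Y, α (gen Γ y) = (gen Γ v)⁻¹ * gen Γ y * gen Γ v) ∧
    (∀ z : V, z ∉ Y → α (gen Γ z) = gen Γ z)

/-- `α` is the inversion `ι_v`. -/
def IsInversion (Γ : SimpleGraph V) (α : MulAut (Raag Γ)) : Prop :=
  ∃ v : V, α (gen Γ v) = (gen Γ v)⁻¹ ∧ ∀ z : V, z ≠ v → α (gen Γ z) = gen Γ z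

/-- `SAut⁰(A_Γ)`: the subgroup generated by transvections and partial conjugations. -/
def SAut0 (Γ : SimpleGraph V) : Subgroup (MulAut (Raag Γ)) :=
  Subgroup.closure {α | IsTransvection Γ α ∨ IsPartialConj Γ α}

/-- `Aut⁰(A_Γ)`: the subgroup generated by transvections, partial conjugations and inversions. -/
def Aut0 (Γ : SimpleGraph V) : Subgroup (MulAut (Raag Γ)) :=
  Subgroup.closure {α | IsTransvection Γ α ∨ IsPartialConj Γ α ∨ IsInversion Γ α}

/-- The natural map `Aut(A_Γ) → Aut(A_Γ^{ab})`. -/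
def abAutHom (Γ : SimpleGraph V) :
    MulAut (Raag Γ) →* MulAut (Abelianization (Raag Γ)) :=
  MonoidHom.mk' (fun e => MulEquiv.abelianizationCongr e) (by
    intro e f
    exact (abelianizationCongr_trans f e).symm)

/-- The Torelli subgroup `IA_Γ`. -/
def IA (Γ : SimpleGraph V) : Subgroup (MulAut (Raag Γ)) := (abAutHom Γ).ker

/-- The subgroup of `m`-th powers of `A_Γ^{ab}`; the quotient by it is `A_Γ^{ab} ⊗ ℤ/mℤ`. -/
def powN (Γ : SimpleGraph V) (m : ℕ) : Subgroup (Abelianization (Raag Γ)) :=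
  (powMonoidHom m : Abelianization (Raag Γ) →* Abelianization (Raag Γ)).range

/-- `IA_Γ(m)`: the kernel of `Aut(A_Γ) → Aut(A_Γ^{ab} ⊗ ℤ/mℤ)`, i.e. the automorphisms
acting trivially on the abelianization modulo `m`-th powers. -/
def IAm (Γ : SimpleGraph V) (m : ℕ) : Subgroup (MulAut (Raag Γ)) where
  carrier := {α | ∀ x : Abelianization (Raag Γ), abAutHom Γ α x * x⁻¹ ∈ powN Γ m}
  one_mem' := by
    intro x
    simp only [map_one, MulAut.one_apply, mul_inv_cancel]
    exact one_mem _
  mul_mem' := by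
    intro a b ha hb x
    have h : abAutHom Γ (a * b) x * x⁻¹ =
        (abAutHom Γ a (abAutHom Γ b x) * (abAutHom Γ b x)⁻¹) * (abAutHom Γ b x * x⁻¹) := by
      simp only [map_mul, MulAut.mul_apply]
      group
    rw [h]
    exact mul_mem (ha _) (hb x)
  inv_mem' := by
    intro a ha x
    have h : abAutHom Γ a (abAutHom Γ a⁻¹ x) = x := by
      have : abAutHom Γ a * abAutHom Γ a⁻¹ = 1 := by
        rw [← map_mul, mul_inv_cancel, map_one]
      calc abAutHom Γ a (abAutHom Γ a⁻¹ x) = (abAutHom Γ a * abAutHom Γ a⁻¹) x := rfl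
        _ = x := by rw [this]; rfl
    have := inv_mem (ha (abAutHom Γ a⁻¹ x))
    rw [h] at this
    simpa [mul_comm] using this
  
/-- `SIA_Γ(m) = SAut⁰(A_Γ) ∩ IA_Γ(m)`. -/
def SIA (Γ : SimpleGraph V) (m : ℕ) : Subgroup (MulAut (Raag Γ)) := SAut0 Γ ⊓ IAm Γ m

/-- The group of inner automorphisms of `A_Γ`. -/
def innSub (Γ : SimpleGraph V) : Subgroup (MulAut (Raag Γ)) :=
  (MulAut.conj : Raag Γ →* MulAut (Raag Γ)).range


/-- Property (NL): three pairwise distinct, pairwise non-adjacent vertices with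
`v₃ ≤ v₁` and `v₃ ≤ v₂`. -/
def NL (Γ : SimpleGraph V) : Prop :=
  ∃ v₁ v₂ v₃ : V, v₁ ≠ v₂ ∧ v₁ ≠ v₃ ∧ v₂ ≠ v₃ ∧
    ¬ Γ.Adj v₁ v₂ ∧ ¬ Γ.Adj v₁ v₃ ∧ ¬ Γ.Adj v₂ v₃ ∧ Le Γ v₃ v₁ ∧ Le Γ v₃ v₂

open Classical in
/-- The multiset of cardinalities of the equivalence classes of vertices under `∼`. -/
noncomputable def classSizes (Γ : SimpleGraph V) : Multiset ℕ :=
  (Finset.image (fun v => Set.toFinset (simClass Γ v)) Finset.univ).val.map Finset.card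

/-- A relational form of a Mennicke symbol of level `m`: `S a b x` says that the symbol of the
pair `(a, b)` is `x`. -/
structure IsMennickeSymbol {Q : Type*} [Group Q] (m : ℕ) (S : ℤ → ℤ → Q → Prop) : Prop where
  isCoprime : ∀ {a b x}, S a b x → IsCoprime a b
  dvd_sub_one : ∀ {a b x}, S a b x → (m : ℤ) ∣ a - 1
  dvd : ∀ {a b x}, S a b x → (m : ℤ) ∣ b
  add_mul_left : ∀ {a b x} (t : ℤ), S a b x → S (a + t * b) b x
  add_mul_right : ∀ {a b x} (t : ℤ), S a b x → S a (b + t * (m * a)) x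
  neg_right : ∀ {a b x}, S a b x → S a (-b) x
  mul : ∀ {a a' b x y}, S a b x → S a' b y → S (a * a') b (x * y)
  eq_one : ∀ {b x}, S 1 b x → x = 1

namespace IsMennickeSymbol

variable {Q : Type*} [Group Q] {m : ℕ} {S : ℤ → ℤ → Q → Prop}

lemma pow (hS : IsMennickeSymbol m S) {a b : ℤ} {x : Q} (h : S a b x) (k : ℕ) :
    S (a ^ (k + 1)) b (x ^ (k + 1)) := by
  induction k with
  | zero => simpa using h
  | succ k ih => simpa only [pow_succ _ (k + 1)] using hS.mul ih h

lemma pow_eq_one (hS : IsMennickeSymbol m S) {a b : ℤ} {x : Q} (h : S a b x) {k : ℕ}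
    (hk : b ∣ a ^ k - 1) : x ^ k = 1 := by
  cases k with
  | zero => simp
  | succ k =>
    obtain ⟨t, ht⟩ := hk
    have h' := hS.add_mul_left (-t) (hS.pow h k)
    rw [show a ^ (k + 1) + -t * b = 1 by linarith] at h'
    exact hS.eq_one h'

lemma eq_one_of_dvd_sub_one (hS : IsMennickeSymbol m S) {a b : ℤ} {x : Q} (h : S a b x)
    (hk : b ∣ a - 1) : x = 1 := by
  simpa using hS.pow_eq_one h (k := 1) (by simpa using hk)

end IsMennickeSymbol

/-- A class coprime to the modulus contains, up to sign, a prime congruent to `3` modulo `4`. -/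
lemma exists_prime_three_mod_four {a b : ℤ} (hb : b ≠ 0) (hab : IsCoprime a b) :
    ∃ (p : ℕ) (ε : ℤ), p.Prime ∧ p % 4 = 3 ∧ (ε = 1 ∨ ε = -1) ∧ b ∣ ε * p - a := by
  have h2 : ¬ (2 ∣ a ∧ 2 ∣ b) := by
    rintro ⟨h1, h2⟩
    have := hab.isUnit_of_dvd' h1 h2
    norm_num [Int.isUnit_iff] at this
  obtain ⟨t, ε, hε, h3⟩ : ∃ t ε : ℤ, (ε = 1 ∨ ε = -1) ∧ (ε * (a + t * b)) % 4 = 3 := by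
    have hb' : b % 4 = 0 ∨ b % 4 = 1 ∨ b % 4 = 2 ∨ b % 4 = 3 := by omega
    have ha' : a % 4 = 0 ∨ a % 4 = 1 ∨ a % 4 = 2 ∨ a % 4 = 3 := by omega
    by_cases h0 : a % 4 = 3
    · exact ⟨0, 1, Or.inl rfl, by omega⟩
    by_cases h1 : a % 4 = 1
    · exact ⟨0, -1, Or.inr rfl, by omega⟩
    by_cases h1 : (a + 1 * b) % 4 = 3
    · exact ⟨1, 1, Or.inl rfl, by omega⟩
    · exact ⟨1, -1, Or.inr rfl, by omega⟩
  have hεu : IsUnit ε := by rcases hε with rfl | rfl <;> simp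
  have hcop : IsCoprime (ε * (a + t * b)) (((4 * b.natAbs : ℕ) : ℤ)) := by
    have e1 : IsCoprime (ε * (a + t * b)) b :=
      (isCoprime_mul_unit_left_left hεu _ _).2 (by simpa [mul_comm] using hab.add_mul_left_left t)
    have e2 : IsCoprime (ε * (a + t * b)) 4 := by
      rw [Int.isCoprime_iff_gcd_eq_one, ← Int.gcd_emod, h3]; rfl
    push_cast
    refine e2.mul_right ?_
    rcases abs_choice b with h | h <;> rw [h]
    · exact e1
    · exact e1.neg_right
  obtain ⟨p, -, hp, hmod⟩ := Nat.forall_exists_prime_gt_and_zmodEq 0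
    (q := 4 * b.natAbs) (by simpa using hb) hcop
  refine ⟨p, ε, hp, ?_, hε, ?_⟩
  · have h4 : (p : ℤ) ≡ ε * (a + t * b) [ZMOD 4] := hmod.of_dvd ⟨b.natAbs, by push_cast; ring⟩
    have := h4.eq
    omega
  · have h4 : (p : ℤ) ≡ ε * (a + t * b) [ZMOD b] :=
      hmod.of_dvd (by push_cast; exact Dvd.dvd.mul_left (by simp) _)
    obtain ⟨u, hu⟩ := h4.symm.dvd
    have hε2 : ε * ε = 1 := by rcases hε with rfl | rfl <;> rfl
    refine ⟨ε * u + t, ?_⟩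
    linear_combination ε * hu + (a + t * b) * hε2

lemma exists_sign_forall_pow_div_two {p : ℕ} [Fact p.Prime] (hp : p % 4 = 3) {ε : ℤ}
    (hε : ε = 1 ∨ ε = -1) {b : ℤ} (hb : ¬ (p : ℤ) ∣ b) :
    ∃ s : ℤ, (s = 1 ∨ s = -1) ∧ ∀ q : ℕ, q.Prime → q % 4 = 3 → (p : ℤ) ∣ q - s * b →
      (q : ℤ) ∣ (ε * p) ^ (q / 2) - 1 := by
  have hb0 : ((b : ℤ) : ZMod p) ≠ 0 := by rwa [Ne, ZMod.intCast_zmod_eq_zero_iff_dvd]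
  have hb1 := legendreSym.eq_one_or_neg_one p hb0
  have key : ∀ (r : ℕ) [Fact r.Prime], r % 4 = 3 → legendreSym r (-1) = -1 := by
    intro r _ hr
    rw [legendreSym.at_neg_one (by omega), ZMod.χ₄_nat_three_mod_four hr]
  have sgn : ∀ (r : ℕ) [Fact r.Prime], r % 4 = 3 → ∀ s : ℤ, (s = 1 ∨ s = -1) →
      legendreSym r s = s := by
    intro r _ hr s hs
    rcases hs with rfl | rfl
    · simp
    · exact key r hr
  have hs : -ε * legendreSym p b = 1 ∨ -ε * legendreSym p b = -1 := by
    rcases hε with rfl | rfl <;> rcases hb1 with h | h <;> simp [h]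
  refine ⟨-ε * legendreSym p b, hs, fun q hq hq4 hqp => ?_⟩
  have : Fact q.Prime := ⟨hq⟩
  have h1 : legendreSym q (ε * p) = 1 := by
    rw [legendreSym.mul, sgn q hq4 ε hε, legendreSym.quadratic_reciprocity_three_mod_four hp hq4]
    have : legendreSym p q = legendreSym p (-ε * legendreSym p b * b) := by
      rw [legendreSym.mod p q, legendreSym.mod p (_ * b)]
      congr 1
      exact (Int.emod_eq_emod_iff_emod_sub_eq_zero.2 (Int.emod_eq_zero_of_dvd hqp))
    rw [this, legendreSym.mul, sgn p hp _ hs]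
    rcases hε with rfl | rfl <;> rcases hb1 with h | h <;> simp [h]
  have h2 := legendreSym.eq_pow q (ε * p)
  rw [h1] at h2
  rw [← ZMod.intCast_zmod_eq_zero_iff_dvd]
  push_cast at h2 ⊢
  rw [← h2]; simp

namespace IsMennickeSymbol

variable {Q : Type*} [Group Q] {m : ℕ} {S : ℤ → ℤ → Q → Prop}

/-- Every Mennicke symbol over the integers is trivial. -/
theorem eq_one_of_pos (hS : IsMennickeSymbol m S) (hm : 0 < m) {a b : ℤ} {x : Q}
    (h : S a b x) : x = 1 := by
  obtain ⟨b, hb0, h⟩ : ∃ b : ℤ, b ≠ 0 ∧ S a b x := by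
    by_cases hb : b = 0
    · subst hb
      have ha : a ≠ 0 := by
        rintro rfl
        exact not_isCoprime_zero_zero (hS.isCoprime h)
      exact ⟨_, by simpa using ⟨hm.ne', ha⟩, hS.add_mul_right 1 h⟩
    · exact ⟨b, hb, h⟩
  obtain ⟨p, ε, hp, hp4, hε, u, hu⟩ := exists_prime_three_mod_four hb0 (hS.isCoprime h)
  obtain rfl : a = ε * p + -u * b := by linarith
  replace h : S (ε * p) b x := by simpa using hS.add_mul_left u h
  obtain ⟨b, rfl⟩ := hS.dvd h
  have hε2 : ε * ε = 1 := by rcases hε with rfl | rfl <;> rfl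
  have hcop : IsCoprime (p : ℤ) b :=
    ((hS.isCoprime h).of_mul_left_right).of_mul_right_right
  have : Fact p.Prime := ⟨hp⟩
  have hpZ : Prime (p : ℤ) := Nat.prime_iff_prime_int.1 hp
  have hpb : ¬ (p : ℤ) ∣ b := fun hd =>
    hpZ.not_isUnit (hcop.isUnit_of_dvd' dvd_rfl hd)
  obtain ⟨s, hs, hq⟩ := exists_sign_forall_pow_div_two hp4 hε hpb
  have h' : S (ε * p) (m * (s * b)) x := by
    rcases hs with rfl | rfl
    · simpa using h
    · simpa using hS.neg_right h
  have hcop' : IsCoprime (s * b) (p : ℤ) := by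
    rcases hs with rfl | rfl
    · simpa using hcop.symm
    · simpa using hcop.symm.neg_left
  clear h
  generalize s * b = c at hq h' hcop'
  have shift : ∀ d : ℤ, (p : ℤ) ∣ d - c → S (ε * p) (m * d) x := by
    rintro d ⟨t, ht⟩
    have := hS.add_mul_right (t * ε) h'
    rwa [show (m : ℤ) * c + t * ε * (m * (ε * p)) = m * d by
      linear_combination (m : ℤ) * t * p * hε2 - m * ht] at this
  have ha1 : (m : ℤ) ∣ ε * p - 1 := hS.dvd_sub_one h'
  by_cases hc1 : (p : ℤ) ∣ 1 - c
  · exact hS.eq_one_of_dvd_sub_one (shift 1 hc1) (by simpa using ha1)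
  have step : ∀ q : ℕ, q.Prime → m < q → q % 4 = 3 → (p : ℤ) ∣ q - c → x ^ (q / 2) = 1 := by
    intro q hqp hqm hq4 hqc
    refine hS.pow_eq_one (shift q hqc) (IsCoprime.mul_dvd ?_ ?_ (hq q hqp hq4 hqc))
    · rw [Nat.isCoprime_iff_coprime]
      exact ((Nat.Prime.coprime_iff_not_dvd hqp).2 (Nat.not_dvd_of_pos_of_lt hm hqm)).symm
    · exact ha1.trans (sub_one_dvd_pow_sub_one _ _)
  have exq : ∀ k : ℕ, Odd k → ¬ p ∣ k → ∃ q : ℕ, q.Prime ∧ m < q ∧ q % 4 = 3 ∧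
      (p : ℤ) ∣ q - c ∧ (k : ℤ) ∣ q + 1 := by
    intro k hk hpk
    have c1 : IsCoprime (4 * k : ℤ) p := by
      have : Nat.Coprime (4 * k) p := by
        refine ((Nat.Prime.coprime_iff_not_dvd hp).2 fun hd => ?_).symm
        rcases (Nat.Prime.dvd_mul hp).1 hd with h | h
        · have := Nat.le_of_dvd (by norm_num) h
          interval_cases p <;> omega
        · exact hpk h
      exact_mod_cast Nat.isCoprime_iff_coprime.2 this
    obtain ⟨u, v, huv⟩ := c1
    have hz : IsCoprime (c * (u * (4 * k)) + (-1) * (v * p)) ((4 * k * p : ℕ) : ℤ) := by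
      push_cast
      refine IsCoprime.mul_right ?_ ?_
      · refine ⟨-1, u * (c + 1), by linear_combination huv⟩
      · obtain ⟨e, f, hef⟩ := hcop'
        refine ⟨e, e * v * (c + 1) + f, by linear_combination hef + e * c * huv⟩
    obtain ⟨q, hqm, hqp, hmod⟩ := Nat.forall_exists_prime_gt_and_zmodEq m
      (by have := hk.pos; have := hp.pos; positivity) hz
    obtain ⟨w, hw⟩ := hmod.symm.dvd
    push_cast at hw
    refine ⟨q, hqp, hqm, ?_, ?_, ?_⟩
    · have : (q : ℤ) = -1 + 4 * (k * (w * p + u * (c + 1))) := by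
        linear_combination hw - huv
      omega
    · exact ⟨w * (4 * k) - v * (c + 1), by linear_combination hw + c * huv⟩
    · exact ⟨4 * (w * p + u * (c + 1)), by linear_combination hw - huv⟩
  obtain ⟨q₁, hq₁, hm₁, h4₁, hc₁, -⟩ := exq 1 odd_one (by simpa using hp.one_lt.ne')
  have hk₁ : Odd (q₁ / 2) := by rw [Nat.odd_iff]; omega
  have hpk₁ : ¬ p ∣ q₁ / 2 := by
    rintro ⟨t, ht⟩
    refine hc1 ?_
    have : (q₁ : ℤ) = 2 * (p * t) + 1 := by
      have : q₁ = 2 * (p * t) + 1 := by omega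
      exact_mod_cast this
    rw [this] at hc₁
    have h2 := dvd_sub hc₁ (Dvd.intro (2 * t : ℤ) rfl : (p : ℤ) ∣ p * (2 * t))
    rwa [show 2 * ((p : ℤ) * t) + 1 - c - p * (2 * t) = 1 - c by ring] at h2
  obtain ⟨q₂, hq₂, hm₂, h4₂, hc₂, hk₂⟩ := exq (q₁ / 2) hk₁ hpk₁
  have hcopk : Nat.Coprime (q₁ / 2) (q₂ / 2) := by
    have e1 : q₁ / 2 ∣ 2 * (q₂ / 2 + 1) := by
      have : q₁ / 2 ∣ q₂ + 1 := by exact_mod_cast hk₂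
      convert this using 1
      omega
    have e2 : q₁ / 2 ∣ q₂ / 2 + 1 := (Nat.Coprime.dvd_of_dvd_mul_left hk₁.coprime_two_right e1)
    exact Nat.Coprime.coprime_dvd_left e2 (by simp)
  have o1 := orderOf_dvd_of_pow_eq_one (step q₁ hq₁ hm₁ h4₁ hc₁)
  have o2 := orderOf_dvd_of_pow_eq_one (step q₂ hq₂ hm₂ h4₂ hc₂)
  exact orderOf_eq_one_iff.1 (Nat.eq_one_of_dvd_coprimes hcopk o1 o2)

end IsMennickeSymbol

section Congruence

open Matrix

section Support

variable {ι : Type*} [Fintype ι] [DecidableEq ι]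

lemma mul_transvection_apply {i j : ι} (hij : i ≠ j) (t : ℤ) (g : SpecialLinearGroup ι ℤ)
    (a b : ι) : (g * Matrix.SpecialLinearGroup.transvection hij t) a b =
      g a b + if b = j then t * g a i else 0 := by
  rw [Matrix.SpecialLinearGroup.coe_mul]
  split_ifs with h
  · subst h
    exact Matrix.mul_transvection_apply_same i b a t _
  · rw [add_zero]
    exact Matrix.mul_transvection_apply_of_ne i j a b h t _

lemma transvection_mul_apply {i j : ι} (hij : i ≠ j) (t : ℤ) (g : SpecialLinearGroup ι ℤ)
    (a b : ι) : (Matrix.SpecialLinearGroup.transvection hij t * g) a b =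
      g a b + if a = i then t * g j b else 0 := by
  rw [Matrix.SpecialLinearGroup.coe_mul]
  split_ifs with h
  · subst h
    exact Matrix.transvection_mul_apply_same a j b t _
  · rw [add_zero]
    exact Matrix.transvection_mul_apply_of_ne i j a b h t _

lemma transvection_apply {i j : ι} (hij : i ≠ j) (t : ℤ) (a b : ι) :
    (Matrix.SpecialLinearGroup.transvection hij t) a b =
      (1 : Matrix ι ι ℤ) a b + if a = i ∧ b = j then t else 0 := by
  simp [Matrix.SpecialLinearGroup.transvection_coe, Matrix.single, eq_comm]

/-- The principal congruence subgroup of level `m`. -/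
def congSubgroup (ι : Type*) [Fintype ι] [DecidableEq ι] (m : ℕ) :
    Subgroup (SpecialLinearGroup ι ℤ) :=
  (Matrix.SpecialLinearGroup.map (Int.castRingHom (ZMod m))).ker

instance (m : ℕ) : (congSubgroup ι m).Normal := by
  unfold congSubgroup
  infer_instance

lemma mem_congSubgroup {m : ℕ} {g : SpecialLinearGroup ι ℤ} :
    g ∈ congSubgroup ι m ↔ ∀ i j, (m : ℤ) ∣ g i j - (1 : Matrix ι ι ℤ) i j := by
  rw [congSubgroup, MonoidHom.mem_ker, Matrix.SpecialLinearGroup.ext_iff]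
  refine forall₂_congr fun i j => ?_
  rw [← ZMod.intCast_zmod_eq_zero_iff_dvd, Int.cast_sub, sub_eq_zero]
  by_cases h : i = j
  · subst h
    simp
  · simp [h]

lemma transvection_mem_congSubgroup {m : ℕ} {i j : ι} (hij : i ≠ j) {t : ℤ} (ht : (m : ℤ) ∣ t) :
    Matrix.SpecialLinearGroup.transvection hij t ∈ congSubgroup ι m := by
  rw [mem_congSubgroup]
  intro a b
  rw [transvection_apply, add_sub_cancel_left]
  split_ifs
  · exact ht
  · exact dvd_zero _

/-- The matrices which agree with the identity outside of `s × s`. -/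
def suppSubgroup (s : Finset ι) : Subgroup (SpecialLinearGroup ι ℤ) where
  carrier := {g | ∀ i j, (i ∉ s ∨ j ∉ s) → g i j = (1 : Matrix ι ι ℤ) i j}
  one_mem' := by simp
  mul_mem' := by
    intro g h hg hh i j hij
    rw [Matrix.SpecialLinearGroup.coe_mul, Matrix.mul_apply]
    rcases hij with hi | hj
    · rw [Finset.sum_congr rfl fun k _ => by rw [hg i k (Or.inl hi)]]
      simpa [Matrix.one_apply] using hh i j (Or.inl hi)
    · rw [Finset.sum_congr rfl fun k _ => by rw [hh k j (Or.inr hj)]]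
      simpa [Matrix.one_apply] using hg i j (Or.inr hj)
  inv_mem' := by
    intro g hg i j hij
    rcases hij with hi | hj
    · have := congrFun (congrFun (congrArg Subtype.val (mul_inv_cancel g)) i) j
      rw [Matrix.SpecialLinearGroup.coe_mul, Matrix.mul_apply,
        Finset.sum_congr rfl fun k _ => by rw [hg i k (Or.inl hi)]] at this
      simpa [Matrix.one_apply] using this
    · have := congrFun (congrFun (congrArg Subtype.val (inv_mul_cancel g)) i) j
      rw [Matrix.SpecialLinearGroup.coe_mul, Matrix.mul_apply,
        Finset.sum_congr rfl fun k _ => by rw [hg k j (Or.inr hj)]] at this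
      simpa [Matrix.one_apply] using this

lemma transvection_mem_suppSubgroup {s : Finset ι} {i j : ι} (hij : i ≠ j) (hi : i ∈ s)
    (hj : j ∈ s) (t : ℤ) : Matrix.SpecialLinearGroup.transvection hij t ∈ suppSubgroup s := by
  intro a b hab
  rw [transvection_apply, if_neg, add_zero]
  rintro ⟨rfl, rfl⟩
  tauto

/-- `N` is normalized by the elementary matrices with indices in `c`, and contains those which
are congruent to the identity modulo `m`. -/
structure IsElementaryStable (c : Finset ι) (m : ℕ) (N : Subgroup (SpecialLinearGroup ι ℤ)) :
    Prop where
  mem : ∀ {i j : ι} (hij : i ≠ j), i ∈ c → j ∈ c →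
    Matrix.SpecialLinearGroup.transvection hij (m : ℤ) ∈ N
  conj_mem : ∀ {i j : ι} (hij : i ≠ j), i ∈ c → j ∈ c → ∀ (t : ℤ), ∀ g ∈ N,
    Matrix.SpecialLinearGroup.transvection hij t * g *
      Matrix.SpecialLinearGroup.transvection hij (-t) ∈ N

lemma transvection_mul_eq_zpow {i j : ι} (hij : i ≠ j)
    (s k : ℤ) : Matrix.SpecialLinearGroup.transvection hij (s * k) =
      Matrix.SpecialLinearGroup.transvection hij s ^ k := by
  induction k with
  | zero => simp [Matrix.SpecialLinearGroup.transvection_coeff_zero]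
  | succ k ih =>
    rw [mul_add, Matrix.SpecialLinearGroup.transvection_add, ih, _root_.zpow_add, mul_one, zpow_one]
  | pred k ih =>
    rw [mul_sub, sub_eq_add_neg, Matrix.SpecialLinearGroup.transvection_add, ih, _root_.zpow_sub,
      mul_one, zpow_one, Matrix.SpecialLinearGroup.transvection_inv]

namespace IsElementaryStable

variable {c : Finset ι} {m : ℕ} {N : Subgroup (SpecialLinearGroup ι ℤ)}

lemma mem_of_dvd (hN : IsElementaryStable c m N) {i j : ι} (hij : i ≠ j) (hi : i ∈ c) (hj : j ∈ c)
    {t : ℤ} (ht : (m : ℤ) ∣ t) : Matrix.SpecialLinearGroup.transvection hij t ∈ N := by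
  obtain ⟨k, rfl⟩ := ht
  rw [transvection_mul_eq_zpow]
  exact zpow_mem (hN.mem hij hi hj) k

lemma mem_of_conj_mem (hN : IsElementaryStable c m N) {i j : ι} (hij : i ≠ j) (hi : i ∈ c)
    (hj : j ∈ c) (t : ℤ) {g : SpecialLinearGroup ι ℤ}
    (h : Matrix.SpecialLinearGroup.transvection hij t * g *
      Matrix.SpecialLinearGroup.transvection hij (-t) ∈ N) : g ∈ N := by
  have := hN.conj_mem hij hi hj (-t) _ h
  rw [neg_neg, ← Matrix.SpecialLinearGroup.transvection_inv] at this
  convert this using 1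
  group

/-- `g'` can be used in place of `g` for the membership in `N` of a matrix supported on `s` and
congruent to the identity modulo `m`. -/
structure Reduces (N : Subgroup (SpecialLinearGroup ι ℤ)) (s : Finset ι) (m : ℕ)
    (g g' : SpecialLinearGroup ι ℤ) : Prop where
  supp : g ∈ suppSubgroup s → g' ∈ suppSubgroup s
  cong : g ∈ congSubgroup ι m → g' ∈ congSubgroup ι m
  mem : g' ∈ N → g ∈ N

lemma Reduces.refl (N : Subgroup (SpecialLinearGroup ι ℤ)) (s : Finset ι) (m : ℕ)
    (g : SpecialLinearGroup ι ℤ) : Reduces N s m g g := ⟨id, id, id⟩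

lemma Reduces.trans {s : Finset ι} {g g' g'' : SpecialLinearGroup ι ℤ} (h : Reduces N s m g g')
    (h' : Reduces N s m g' g'') : Reduces N s m g g'' :=
  ⟨h'.supp ∘ h.supp, h'.cong ∘ h.cong, h.mem ∘ h'.mem⟩

lemma reduces_conj (hN : IsElementaryStable c m N) {s : Finset ι} (hs : s ⊆ c) {i j : ι}
    (hij : i ≠ j) (hi : i ∈ s) (hj : j ∈ s) (t : ℤ) (g : SpecialLinearGroup ι ℤ) :
    Reduces N s m g (Matrix.SpecialLinearGroup.transvection hij t * g *
      Matrix.SpecialLinearGroup.transvection hij (-t)) where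
  supp h := mul_mem (mul_mem (transvection_mem_suppSubgroup hij hi hj t) h)
    (transvection_mem_suppSubgroup hij hi hj _)
  cong h := by
    rw [← Matrix.SpecialLinearGroup.transvection_inv]
    exact Subgroup.Normal.conj_mem inferInstance _ h _
  mem := hN.mem_of_conj_mem hij (hs hi) (hs hj) t

lemma reduces_mul_right (hN : IsElementaryStable c m N) {s : Finset ι} (hs : s ⊆ c) {i j : ι}
    (hij : i ≠ j) (hi : i ∈ s) (hj : j ∈ s) {t : ℤ} (ht : (m : ℤ) ∣ t)
    (g : SpecialLinearGroup ι ℤ) :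
    Reduces N s m g (g * Matrix.SpecialLinearGroup.transvection hij t) where
  supp h := mul_mem h (transvection_mem_suppSubgroup hij hi hj t)
  cong h := mul_mem h (transvection_mem_congSubgroup hij ht)
  mem := (Subgroup.mul_mem_cancel_right _ (hN.mem_of_dvd hij (hs hi) (hs hj) ht)).1

lemma reduces_mul_left (hN : IsElementaryStable c m N) {s : Finset ι} (hs : s ⊆ c) {i j : ι}
    (hij : i ≠ j) (hi : i ∈ s) (hj : j ∈ s) {t : ℤ} (ht : (m : ℤ) ∣ t)
    (g : SpecialLinearGroup ι ℤ) :
    Reduces N s m g (Matrix.SpecialLinearGroup.transvection hij t * g) where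
  supp h := mul_mem (transvection_mem_suppSubgroup hij hi hj t) h
  cong h := mul_mem (transvection_mem_congSubgroup hij ht) h
  mem := (Subgroup.mul_mem_cancel_left _ (hN.mem_of_dvd hij (hs hi) (hs hj) ht)).1

lemma exists_reduces_row_subsingleton (hN : IsElementaryStable c m N) {s : Finset ι} (hs : s ⊆ c)
    {r : ι} (g : SpecialLinearGroup ι ℤ) :
    ∃ g', Reduces N s m g g' ∧
      ∀ p ∈ s, ∀ q ∈ s, p ≠ r → q ≠ r → g' r p ≠ 0 → g' r q ≠ 0 → p = q := by
  induction hn : ∑ j, (g r j).natAbs using Nat.strong_induction_on generalizing g with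
  | _ n ih =>
    by_cases hg : ∀ p ∈ s, ∀ q ∈ s, p ≠ r → q ≠ r → g r p ≠ 0 → g r q ≠ 0 → p = q
    · exact ⟨g, Reduces.refl .., hg⟩
    obtain ⟨p, hp, q, hq, hpr, hqr, hp0, hq0, hpq, hle⟩ : ∃ p ∈ s, ∃ q ∈ s, p ≠ r ∧ q ≠ r ∧
        g r p ≠ 0 ∧ g r q ≠ 0 ∧ p ≠ q ∧ (g r p).natAbs ≤ (g r q).natAbs := by
      push Not at hg
      obtain ⟨p, hp, q, hq, hpr, hqr, hp0, hq0, hpq⟩ := hg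
      rcases le_total (g r p).natAbs (g r q).natAbs with h | h
      · exact ⟨p, hp, q, hq, hpr, hqr, hp0, hq0, hpq, h⟩
      · exact ⟨q, hq, p, hp, hqr, hpr, hq0, hp0, hpq.symm, h⟩
    set t := g r q / g r p
    set g₁ := Matrix.SpecialLinearGroup.transvection hpq t * g *
      Matrix.SpecialLinearGroup.transvection hpq (-t) with hg₁
    have e : ∀ j, g₁ r j = if j = q then g r q % g r p else g r j := by
      intro j
      rw [hg₁, mul_transvection_apply, transvection_mul_apply, transvection_mul_apply,
        if_neg hpr.symm, if_neg hpr.symm]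
      split_ifs with h
      · rw [h, Int.emod_def]
        ring
      · ring
    have hmod : (g r q % g r p).natAbs < (g r q).natAbs := by
      refine lt_of_lt_of_le ?_ hle
      rw [← Nat.cast_lt (α := ℤ), Int.natCast_natAbs, Int.natCast_natAbs,
        abs_of_nonneg (Int.emod_nonneg _ hp0)]
      exact Int.emod_lt_abs _ hp0
    have hlt : ∑ j, (g₁ r j).natAbs < n := by
      rw [← hn]
      refine Finset.sum_lt_sum (fun j _ => ?_) ⟨q, Finset.mem_univ q, ?_⟩
      · rw [e]
        split_ifs with h
        · subst h
          exact hmod.le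
        · exact le_rfl
      · rw [e, if_pos rfl]
        exact hmod
    obtain ⟨g', h, h'⟩ := ih _ hlt g₁ rfl
    exact ⟨g', (hN.reduces_conj hs hpq hp hq t g).trans h, h'⟩

lemma exists_reduces_row (hN : IsElementaryStable c m N) {s : Finset ι} (hs : s ⊆ c)
    (hcard : 3 ≤ s.card) {r : ι} (hr : r ∈ s) {g : SpecialLinearGroup ι ℤ}
    (hg : g ∈ suppSubgroup s) (hgm : g ∈ congSubgroup ι m) :
    ∃ g', Reduces N s m g g' ∧ ∀ j, g' r j = (1 : Matrix ι ι ℤ) r j := by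
  obtain ⟨g₀, h₀, hrow⟩ := hN.exists_reduces_row_subsingleton hs (r := r) g
  obtain ⟨p, hp, q, hq, hpr, hqr, hpq, hz⟩ : ∃ p ∈ s, ∃ q ∈ s, p ≠ r ∧ q ≠ r ∧ p ≠ q ∧
      ∀ j, j ≠ r → j ≠ p → g₀ r j = 0 := by
    obtain ⟨p, hp, hpr, hz⟩ : ∃ p ∈ s, p ≠ r ∧ ∀ j ∈ s, j ≠ r → j ≠ p → g₀ r j = 0 := by
      by_cases h : ∃ p ∈ s, p ≠ r ∧ g₀ r p ≠ 0
      · obtain ⟨p, hp, hpr, hp0⟩ := h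
        refine ⟨p, hp, hpr, fun j hj hjr hjp => ?_⟩
        by_contra hj0
        exact hjp (hrow j hj p hp hjr hpr hj0 hp0)
      · push Not at h
        obtain ⟨p, hp, hpr⟩ := Finset.exists_mem_ne (by omega : 1 < s.card) r
        exact ⟨p, hp, hpr, fun j hj hjr _ => h j hj hjr⟩
    obtain ⟨q, hq⟩ : ((s.erase r).erase p).Nonempty := by
      rw [← Finset.card_pos, Finset.card_erase_of_mem (Finset.mem_erase.2 ⟨hpr, hp⟩),
        Finset.card_erase_of_mem hr]
      omega
    simp only [Finset.mem_erase] at hq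
    refine ⟨p, hp, q, hq.2.2, hpr, hq.2.1, hq.1.symm, fun j hjr hjp => ?_⟩
    by_cases hj : j ∈ s
    · exact hz j hj hjr hjp
    · rw [h₀.supp hg r j (Or.inr hj), Matrix.one_apply_ne hjr.symm]
  have hm₀ := mem_congSubgroup.1 (h₀.cong hgm)
  obtain ⟨k, hk⟩ : (m : ℤ) ∣ g₀ r r - 1 := by simpa using hm₀ r r
  have hd : (m : ℤ) ∣ g₀ r p := by simpa [Matrix.one_apply_ne hpr.symm] using hm₀ r p
  obtain ⟨x, y, hxy⟩ : ∃ x y : ℤ, g₀ r r * x + g₀ r p * y = 1 := by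
    refine ⟨g₀⁻¹ r r, g₀⁻¹ p r, ?_⟩
    have := congrFun (congrFun (congrArg Subtype.val (mul_inv_cancel g₀)) r) r
    rw [Matrix.SpecialLinearGroup.coe_mul, Matrix.mul_apply,
      ← Finset.sum_subset (Finset.subset_univ {r, p}), Finset.sum_pair hpr.symm] at this
    · simpa using this
    · intro j _ hj
      simp only [Finset.mem_insert, Finset.mem_singleton, not_or] at hj
      rw [hz j hj.1 hj.2, zero_mul]
  set g₁ := g₀ * Matrix.SpecialLinearGroup.transvection hqr.symm (m * -(k * x)) with hg₁
  set g₂ := g₁ * Matrix.SpecialLinearGroup.transvection hpq (m * -(k * y)) with hg₂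
  set g₃ := Matrix.SpecialLinearGroup.transvection hqr (-1) * g₂ *
    Matrix.SpecialLinearGroup.transvection hqr (- -1) with hg₃
  set g₄ := g₃ * Matrix.SpecialLinearGroup.transvection hpr.symm (-g₀ r p) with hg₄
  set g₅ := g₄ * Matrix.SpecialLinearGroup.transvection hqr.symm (m * k) with hg₅
  have h₁ : Reduces N s m g₀ g₁ := hN.reduces_mul_right hs _ hr hq (dvd_mul_right _ _) _
  have h₂ : Reduces N s m g₁ g₂ := hN.reduces_mul_right hs _ hp hq (dvd_mul_right _ _) _
  have h₃ : Reduces N s m g₂ g₃ := hN.reduces_conj hs _ hq hr _ _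
  have h₄ : Reduces N s m g₃ g₄ := hN.reduces_mul_right hs _ hr hp ((dvd_neg).2 hd) _
  have h₅ : Reduces N s m g₄ g₅ := hN.reduces_mul_right hs _ hr hq (dvd_mul_right _ _) _
  refine ⟨g₅, ((((h₀.trans h₁).trans h₂).trans h₃).trans h₄).trans h₅, fun j => ?_⟩
  have hq₀ : g₀ r q = 0 := hz q hqr hpq.symm
  have e₁ : ∀ j, g₁ r j = g₀ r j + if j = q then m * -(k * x) * g₀ r r else 0 :=
    fun j => mul_transvection_apply _ _ _ _ _
  have e₂ : ∀ j, g₂ r j = if j = q then -(m * k) else g₀ r j := by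
    intro j
    rw [hg₂, mul_transvection_apply, e₁, e₁, if_neg hpq]
    split_ifs with h
    · rw [h, hq₀]
      linear_combination (-(m * k : ℤ)) * hxy
    · ring
  have e₃ : ∀ j, g₃ r j = if j = q then -(m * k) else if j = r then 1 else g₀ r j := by
    intro j
    rw [hg₃, mul_transvection_apply, transvection_mul_apply, transvection_mul_apply,
      if_neg hqr.symm, if_neg hqr.symm, e₂, e₂, if_pos rfl]
    split_ifs with h h' h'
    · exact absurd (h'.symm.trans h) hqr.symm
    · ring
    · rw [h']
      linear_combination hk
    · ring
  have e₄ : ∀ j, g₄ r j = if j = q then -(m * k) else if j = r then 1 else 0 := by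
    intro j
    rw [hg₄, mul_transvection_apply, e₃, e₃, if_neg hqr.symm, if_pos rfl]
    split_ifs with h h' h' h'' h''
    · exact absurd (h'.symm.trans h) hpq
    · ring
    · exact absurd (h''.symm.trans h') hpr
    · ring
    · rw [h'']
      ring
    · simp [hz j h' h'']
  rw [hg₅, mul_transvection_apply, e₄, e₄, if_neg hqr.symm, if_pos rfl, Matrix.one_apply]
  by_cases h : j = q
  · simp [h, hqr.symm]
  by_cases h' : j = r
  · simp [h', hqr.symm]
  · simp [h, h', Ne.symm h']

lemma exists_reduces_erase (hN : IsElementaryStable c m N) {s : Finset ι} (hs : s ⊆ c)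
    (hcard : 3 ≤ s.card) {r : ι} (hr : r ∈ s) {g : SpecialLinearGroup ι ℤ}
    (hg : g ∈ suppSubgroup s) (hgm : g ∈ congSubgroup ι m) :
    ∃ g', Reduces N s m g g' ∧ g' ∈ suppSubgroup (s.erase r) := by
  obtain ⟨g₀, h₀, hrow⟩ := hN.exists_reduces_row hs hcard hr hg hgm
  have key : ∀ u ⊆ s.erase r, ∃ g', Reduces N s m g g' ∧
      (∀ j, g' r j = (1 : Matrix ι ι ℤ) r j) ∧ ∀ i ∈ u, g' i r = 0 := by
    intro u
    induction u using Finset.induction_on with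
    | empty => exact fun _ => ⟨g₀, h₀, hrow, by simp⟩
    | insert a u ha ih =>
      intro hu
      obtain ⟨g₁, h₁, hrow₁, hcol⟩ := ih ((Finset.subset_insert a u).trans hu)
      obtain ⟨har, has⟩ := Finset.mem_erase.1 (hu (Finset.mem_insert_self a u))
      have hd : (m : ℤ) ∣ g₁ a r := by
        simpa [Matrix.one_apply_ne har] using mem_congSubgroup.1 (h₁.cong hgm) a r
      refine ⟨_, h₁.trans (hN.reduces_mul_left hs har has hr ((dvd_neg).2 hd) g₁), fun j => ?_,
        fun i hiu => ?_⟩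
      · rw [transvection_mul_apply, if_neg har.symm, add_zero, hrow₁]
      · rw [transvection_mul_apply, hrow₁]
        rcases Finset.mem_insert.1 hiu with rfl | hi
        · simp
        · rw [hcol i hi, if_neg (by rintro rfl; exact ha hi), add_zero]
  obtain ⟨g', h, hrow', hcol⟩ := key _ subset_rfl
  refine ⟨g', h, fun i j hij => ?_⟩
  by_cases hi : i = r
  · rw [hi, hrow']
  by_cases hj : j = r
  · by_cases his : i ∈ s
    · rw [hj, hcol i (Finset.mem_erase.2 ⟨hi, his⟩), Matrix.one_apply_ne hi]
    · exact h.supp hg i j (Or.inl his)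
  · refine h.supp hg i j (hij.imp (fun h his => h ?_) (fun h his => h ?_)) <;>
    exact Finset.mem_erase.2 ⟨by assumption, his⟩

/-- If `N` contains the matrices congruent to the identity modulo `m` which are supported on pairs
of indices in `c`, then `N` contains all those supported on `c`. -/
theorem mem_of_pairs (hN : IsElementaryStable c m N) (hc : 2 ≤ c.card)
    (hpair : ∀ i ∈ c, ∀ j ∈ c, i ≠ j → ∀ g ∈ suppSubgroup {i, j}, g ∈ congSubgroup ι m → g ∈ N)
    {g : SpecialLinearGroup ι ℤ} (hg : g ∈ suppSubgroup c) (hgm : g ∈ congSubgroup ι m) :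
    g ∈ N := by
  have key : ∀ n, ∀ s ⊆ c, s.card = n + 2 → ∀ g ∈ suppSubgroup s, g ∈ congSubgroup ι m →
      g ∈ N := by
    intro n
    induction n with
    | zero =>
      intro s hs hcard g hg hgm
      obtain ⟨i, j, hij, rfl⟩ := Finset.card_eq_two.1 hcard
      exact hpair i (hs (by simp)) j (hs (by simp)) hij g hg hgm
    | succ n ih =>
      intro s hs hcard g hg hgm
      obtain ⟨r, hr⟩ : s.Nonempty := Finset.card_pos.1 (by omega)
      obtain ⟨g', h, hg'⟩ := hN.exists_reduces_erase hs (by omega) hr hg hgm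
      refine h.mem (ih _ ((Finset.erase_subset r s).trans hs) ?_ g' hg' (h.cong hgm))
      rw [Finset.card_erase_of_mem hr, hcard]
      omega
  exact key (c.card - 2) c subset_rfl (by omega) g hg hgm

end IsElementaryStable

end Support

section Embedding

variable {ι κ : Type*} [DecidableEq ι]

/-- The `0`-`1` matrix of an embedding. -/
def embedMatrix (f : κ ↪ ι) : Matrix ι κ ℤ := fun a i => if a = f i then 1 else 0

lemma embedMatrix_transpose_mul_self [Fintype ι] [DecidableEq κ] (f : κ ↪ ι) :
    (embedMatrix f)ᵀ * embedMatrix f = 1 := by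
  ext i j
  simp [embedMatrix, Matrix.mul_apply, Matrix.one_apply, eq_comm]

variable [Fintype κ]

lemma embedMatrix_mul_mul_apply (f : κ ↪ ι) (M : Matrix κ κ ℤ) (i j : κ) :
    (embedMatrix f * M * (embedMatrix f)ᵀ) (f i) (f j) = M i j := by
  classical
  simp [embedMatrix, Matrix.mul_apply]

lemma embedMatrix_mul_mul_apply_of_notMem (f : κ ↪ ι) (M : Matrix κ κ ℤ) {a b : ι}
    (h : a ∉ Set.range f ∨ b ∉ Set.range f) :
    (embedMatrix f * M * (embedMatrix f)ᵀ) a b = 0 := by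
  rcases h with h | h
  · have h' : ∀ i, a ≠ f i := fun i hi => h ⟨i, hi.symm⟩
    simp [embedMatrix, Matrix.mul_apply, h']
  · have h' : ∀ i, b ≠ f i := fun i hi => h ⟨i, hi.symm⟩
    simp [embedMatrix, Matrix.mul_apply, h']

variable [Fintype ι] [DecidableEq κ]

lemma det_one_add_embedMatrix (f : κ ↪ ι) (M : Matrix κ κ ℤ) :
    (1 + embedMatrix f * (M - 1) * (embedMatrix f)ᵀ).det = M.det := by
  rw [Matrix.mul_assoc, Matrix.det_one_add_mul_comm, Matrix.mul_assoc,
    embedMatrix_transpose_mul_self, mul_one, add_sub_cancel]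

lemma one_add_embedMatrix_mul (f : κ ↪ ι) (A B : Matrix κ κ ℤ) :
    1 + embedMatrix f * (A * B - 1) * (embedMatrix f)ᵀ =
      (1 + embedMatrix f * (A - 1) * (embedMatrix f)ᵀ) *
        (1 + embedMatrix f * (B - 1) * (embedMatrix f)ᵀ) := by
  have h := embedMatrix_transpose_mul_self f
  generalize embedMatrix f = P at h
  have e : P * (A - 1) * Pᵀ * (P * (B - 1) * Pᵀ) = P * ((A - 1) * (B - 1)) * Pᵀ := by
    simp only [Matrix.mul_assoc]
    rw [← Matrix.mul_assoc Pᵀ P, h, Matrix.one_mul]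
  rw [add_mul, one_mul, mul_add, mul_one, e, add_assoc, ← Matrix.add_mul, ← Matrix.mul_add,
    ← Matrix.add_mul, ← Matrix.mul_add]
  congr 3
  noncomm_ring

/-- Extend a matrix by the identity along an embedding of index sets. -/
def embedSL (f : κ ↪ ι) : SpecialLinearGroup κ ℤ →* SpecialLinearGroup ι ℤ :=
  MonoidHom.mk' (fun M => ⟨1 + embedMatrix f * (M.1 - 1) * (embedMatrix f)ᵀ,
    (det_one_add_embedMatrix f M.1).trans M.2⟩)
    fun A B => Subtype.ext (one_add_embedMatrix_mul f A.1 B.1)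

lemma coe_embedSL (f : κ ↪ ι) (M : SpecialLinearGroup κ ℤ) :
    (embedSL f M : Matrix ι ι ℤ) = 1 + embedMatrix f * (M.1 - 1) * (embedMatrix f)ᵀ := rfl

lemma embedSL_apply (f : κ ↪ ι) (M : SpecialLinearGroup κ ℤ) (i j : κ) :
    embedSL f M (f i) (f j) = M i j := by
  rw [coe_embedSL, Matrix.add_apply, embedMatrix_mul_mul_apply, Matrix.sub_apply]
  simp [Matrix.one_apply]

lemma embedSL_apply_of_notMem (f : κ ↪ ι) (M : SpecialLinearGroup κ ℤ) {a b : ι}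
    (h : a ∉ Set.range f ∨ b ∉ Set.range f) : embedSL f M a b = (1 : Matrix ι ι ℤ) a b := by
  rw [coe_embedSL, Matrix.add_apply, embedMatrix_mul_mul_apply_of_notMem f _ h, add_zero]

lemma eq_embedSL (f : κ ↪ ι) (M : SpecialLinearGroup κ ℤ) (g : SpecialLinearGroup ι ℤ)
    (h : ∀ i j, g (f i) (f j) = M i j)
    (h' : ∀ a b, (a ∉ Set.range f ∨ b ∉ Set.range f) → g a b = (1 : Matrix ι ι ℤ) a b) :
    g = embedSL f M := by
  ext a b
  by_cases hab : a ∉ Set.range f ∨ b ∉ Set.range f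
  · rw [h' a b hab, embedSL_apply_of_notMem f M hab]
  · push Not at hab
    obtain ⟨⟨i, rfl⟩, j, rfl⟩ := hab
    rw [h, embedSL_apply]

lemma exists_embedSL_eq (f : κ ↪ ι) {g : SpecialLinearGroup ι ℤ}
    (h : ∀ a b, (a ∉ Set.range f ∨ b ∉ Set.range f) → g a b = (1 : Matrix ι ι ℤ) a b) :
    ∃ M : SpecialLinearGroup κ ℤ, (∀ i j, M i j = g (f i) (f j)) ∧ embedSL f M = g := by
  let A : Matrix κ κ ℤ := fun i j => g (f i) (f j)
  have hA : (g : Matrix ι ι ℤ) = 1 + embedMatrix f * (A - 1) * (embedMatrix f)ᵀ := by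
    ext a b
    by_cases hab : a ∉ Set.range f ∨ b ∉ Set.range f
    · rw [h a b hab, Matrix.add_apply, embedMatrix_mul_mul_apply_of_notMem f _ hab, add_zero]
    · push Not at hab
      obtain ⟨⟨i, rfl⟩, j, rfl⟩ := hab
      rw [Matrix.add_apply, embedMatrix_mul_mul_apply, Matrix.sub_apply]
      simp [A, Matrix.one_apply]
  have hdet : A.det = 1 := by
    rw [← det_one_add_embedMatrix f, ← hA, g.2]
  exact ⟨⟨A, hdet⟩, fun i j => rfl, Subtype.ext hA.symm⟩

lemma embedSL_transvection (f : κ ↪ ι) {i j : κ} (hij : i ≠ j) (t : ℤ) :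
    embedSL f (Matrix.SpecialLinearGroup.transvection hij t) =
      Matrix.SpecialLinearGroup.transvection (f.injective.ne hij) t := by
  symm
  apply eq_embedSL
  · intro a b
    simp [transvection_apply, Matrix.one_apply]
  · intro a b hab
    rw [transvection_apply, if_neg, add_zero]
    rintro ⟨rfl, rfl⟩
    simp at hab

lemma subgroup_SL_two_eq_top (H : Subgroup (SpecialLinearGroup (Fin 2) ℤ))
    (h : ∀ (i j : Fin 2) (hij : i ≠ j) (t : ℤ),
      Matrix.SpecialLinearGroup.transvection hij t ∈ H) : H = ⊤ := by
  rw [eq_top_iff, ← _root_.SpecialLinearGroup.SL2Z_generators, Subgroup.closure_le]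
  have hT : ModularGroup.T =
      Matrix.SpecialLinearGroup.transvection (show (0 : Fin 2) ≠ 1 by decide) 1 := by
    ext i j
    fin_cases i <;> fin_cases j <;> simp [ModularGroup.T, transvection_apply]
  have hS : ModularGroup.S =
      Matrix.SpecialLinearGroup.transvection (show (0 : Fin 2) ≠ 1 by decide) (-1) *
      Matrix.SpecialLinearGroup.transvection (show (1 : Fin 2) ≠ 0 by decide) 1 *
      Matrix.SpecialLinearGroup.transvection (show (0 : Fin 2) ≠ 1 by decide) (-1) := by
    ext i j
    fin_cases i <;> fin_cases j <;>
      simp [ModularGroup.S, mul_transvection_apply, transvection_apply]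
  rintro x (rfl | rfl)
  · rw [hS]
    exact mul_mem (mul_mem (h _ _ _ _) (h _ _ _ _)) (h _ _ _ _)
  · rw [hT]
    exact h _ _ _ _

/-- `SL₃(ℤ)` is generated by elementary matrices. -/
theorem subgroup_SL_three_eq_top (H : Subgroup (SpecialLinearGroup (Fin 3) ℤ))
    (h : ∀ (i j : Fin 3) (hij : i ≠ j) (t : ℤ),
      Matrix.SpecialLinearGroup.transvection hij t ∈ H) : H = ⊤ := by
  have hH : IsElementaryStable Finset.univ 1 H :=
    ⟨fun hij _ _ => h _ _ hij _, fun hij _ _ t g hg => mul_mem (mul_mem (h _ _ _ _) hg) (h _ _ _ _)⟩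
  refine eq_top_iff.2 fun g _ => hH.mem_of_pairs (by decide) (fun i _ j _ hij g hg _ => ?_)
    (fun i j hij => by simp at hij) (mem_congSubgroup.2 fun i j => by simp)
  let f : Fin 2 ↪ Fin 3 := ⟨![i, j], by
    intro a b
    fin_cases a <;> fin_cases b <;> simp [hij, hij.symm]⟩
  have hf : ∀ a, a ∈ Set.range f ↔ a ∈ ({i, j} : Finset (Fin 3)) := by
    intro a
    rw [Set.mem_range, Fin.exists_fin_two]
    change i = a ∨ j = a ↔ _
    simp [eq_comm]
  obtain ⟨M, -, rfl⟩ := exists_embedSL_eq f (g := g) (fun a b hab => hg a b (by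
    rwa [← hf, ← hf]))
  have htop := subgroup_SL_two_eq_top (H.comap (embedSL f)) fun a b hab t => by
    rw [Subgroup.mem_comap, embedSL_transvection]
    exact h _ _ _ _
  exact (htop ▸ Subgroup.mem_top M : M ∈ H.comap (embedSL f))

end Embedding

/-- The elementary matrix of `SL₃(ℤ)` with entry `t` in position `(0, 1)`. -/
abbrev elem01 (t : ℤ) : SpecialLinearGroup (Fin 3) ℤ :=
  Matrix.SpecialLinearGroup.transvection (show (0 : Fin 3) ≠ 1 by decide) t

lemma coe_elem01 (t : ℤ) :
    (elem01 t : Matrix (Fin 3) (Fin 3) ℤ) = !![1, t, 0; 0, 1, 0; 0, 0, 1] := by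
  ext i j
  fin_cases i <;> fin_cases j <;> simp [Matrix.SpecialLinearGroup.transvection_coe]

/-- The elementary matrix of `SL₃(ℤ)` with entry `t` in position `(0, 2)`. -/
abbrev elem02 (t : ℤ) : SpecialLinearGroup (Fin 3) ℤ :=
  Matrix.SpecialLinearGroup.transvection (show (0 : Fin 3) ≠ 2 by decide) t

lemma coe_elem02 (t : ℤ) :
    (elem02 t : Matrix (Fin 3) (Fin 3) ℤ) = !![1, 0, t; 0, 1, 0; 0, 0, 1] := by
  ext i j
  fin_cases i <;> fin_cases j <;> simp [Matrix.SpecialLinearGroup.transvection_coe]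

/-- The elementary matrix of `SL₃(ℤ)` with entry `t` in position `(1, 0)`. -/
abbrev elem10 (t : ℤ) : SpecialLinearGroup (Fin 3) ℤ :=
  Matrix.SpecialLinearGroup.transvection (show (1 : Fin 3) ≠ 0 by decide) t

lemma coe_elem10 (t : ℤ) :
    (elem10 t : Matrix (Fin 3) (Fin 3) ℤ) = !![1, 0, 0; t, 1, 0; 0, 0, 1] := by
  ext i j
  fin_cases i <;> fin_cases j <;> simp [Matrix.SpecialLinearGroup.transvection_coe]

/-- The elementary matrix of `SL₃(ℤ)` with entry `t` in position `(1, 2)`. -/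
abbrev elem12 (t : ℤ) : SpecialLinearGroup (Fin 3) ℤ :=
  Matrix.SpecialLinearGroup.transvection (show (1 : Fin 3) ≠ 2 by decide) t

lemma coe_elem12 (t : ℤ) :
    (elem12 t : Matrix (Fin 3) (Fin 3) ℤ) = !![1, 0, 0; 0, 1, t; 0, 0, 1] := by
  ext i j
  fin_cases i <;> fin_cases j <;> simp [Matrix.SpecialLinearGroup.transvection_coe]

/-- The elementary matrix of `SL₃(ℤ)` with entry `t` in position `(2, 0)`. -/
abbrev elem20 (t : ℤ) : SpecialLinearGroup (Fin 3) ℤ :=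
  Matrix.SpecialLinearGroup.transvection (show (2 : Fin 3) ≠ 0 by decide) t

lemma coe_elem20 (t : ℤ) :
    (elem20 t : Matrix (Fin 3) (Fin 3) ℤ) = !![1, 0, 0; 0, 1, 0; t, 0, 1] := by
  ext i j
  fin_cases i <;> fin_cases j <;> simp [Matrix.SpecialLinearGroup.transvection_coe]

/-- The elementary matrix of `SL₃(ℤ)` with entry `t` in position `(2, 1)`. -/
abbrev elem21 (t : ℤ) : SpecialLinearGroup (Fin 3) ℤ :=
  Matrix.SpecialLinearGroup.transvection (show (2 : Fin 3) ≠ 1 by decide) t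

lemma coe_elem21 (t : ℤ) :
    (elem21 t : Matrix (Fin 3) (Fin 3) ℤ) = !![1, 0, 0; 0, 1, 0; 0, t, 1] := by
  ext i j
  fin_cases i <;> fin_cases j <;> simp [Matrix.SpecialLinearGroup.transvection_coe]

/-- The matrix with rows `(a, b)`, `(c, d)`, placed in the upper left corner. -/
def cornerSL (a b c d : ℤ) (h : a * d - b * c = 1) : SpecialLinearGroup (Fin 3) ℤ :=
  ⟨!![a, b, 0; c, d, 0; 0, 0, 1], by simp [det_fin_three, h]⟩

lemma coe_cornerSL (a b c d : ℤ) (h : a * d - b * c = 1) :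
    (cornerSL a b c d h : Matrix (Fin 3) (Fin 3) ℤ) = !![a, b, 0; c, d, 0; 0, 0, 1] := rfl

section

variable {Q : Type*} [Group Q] {ρ : SpecialLinearGroup (Fin 3) ℤ →* Q} {m : ℕ}

lemma map_transvection_eq_of_dvd
    (hρ : ∀ (i j : Fin 3) (hij : i ≠ j), ρ (Matrix.SpecialLinearGroup.transvection hij (m : ℤ)) = 1)
    {i j : Fin 3} (hij : i ≠ j) {s : ℤ} (t : ℤ) (h : (m : ℤ) ∣ s - t) :
    ρ (Matrix.SpecialLinearGroup.transvection hij s) =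
      ρ (Matrix.SpecialLinearGroup.transvection hij t) := by
  obtain ⟨k, hk⟩ := h
  rw [show s = t + m * k by linarith, Matrix.SpecialLinearGroup.transvection_add, map_mul,
    transvection_mul_eq_zpow, map_zpow, hρ]
  simp

lemma map_transvection_eq_one_of_dvd
    (hρ : ∀ (i j : Fin 3) (hij : i ≠ j), ρ (Matrix.SpecialLinearGroup.transvection hij (m : ℤ)) = 1)
    {i j : Fin 3} (hij : i ≠ j) {s : ℤ} (h : (m : ℤ) ∣ s) :
    ρ (Matrix.SpecialLinearGroup.transvection hij s) = 1 := by
  rw [map_transvection_eq_of_dvd hρ hij 0 (by simpa using h),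
    Matrix.SpecialLinearGroup.transvection_coeff_zero, map_one]

lemma commute_map_cornerSL
    (hρ : ∀ (i j : Fin 3) (hij : i ≠ j), ρ (Matrix.SpecialLinearGroup.transvection hij (m : ℤ)) = 1)
    {a b c d : ℤ} (h : a * d - b * c = 1) (ha : (m : ℤ) ∣ a - 1) (hb : (m : ℤ) ∣ b)
    (hc : (m : ℤ) ∣ c) (hd : (m : ℤ) ∣ d - 1) (g : SpecialLinearGroup (Fin 3) ℤ) :
    ρ (cornerSL a b c d h) * ρ g = ρ g * ρ (cornerSL a b c d h) := by
  let H : Subgroup (SpecialLinearGroup (Fin 3) ℤ) :=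
    (Subgroup.centralizer {ρ (cornerSL a b c d h)}).comap ρ
  have memH : ∀ g, g ∈ H ↔ ρ (cornerSL a b c d h) * ρ g = ρ g * ρ (cornerSL a b c d h) := by
    intro g
    simp [H, Subgroup.mem_centralizer_singleton_iff, eq_comm]
  have h02 : ∀ t : ℤ, elem02 t ∈ H := by
    intro t
    have e : cornerSL a b c d h * elem02 t =
        elem02 (t * a) * elem12 (t * c) * cornerSL a b c d h := by
      apply Subtype.ext
      simp only [Matrix.SpecialLinearGroup.coe_mul, coe_cornerSL, coe_elem02, coe_elem12]
      ext i j
      fin_cases i <;> fin_cases j <;> simp [Matrix.mul_apply, Fin.sum_univ_three, mul_comm]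
    rw [memH, ← map_mul, e, map_mul, map_mul, map_transvection_eq_one_of_dvd hρ _ (hc.mul_left t),
      mul_one, map_transvection_eq_of_dvd hρ _ t (by simpa [mul_sub] using ha.mul_left t)]
  have h12 : ∀ t : ℤ, elem12 t ∈ H := by
    intro t
    have e : cornerSL a b c d h * elem12 t =
        elem12 (t * d) * elem02 (t * b) * cornerSL a b c d h := by
      apply Subtype.ext
      simp only [Matrix.SpecialLinearGroup.coe_mul, coe_cornerSL, coe_elem02, coe_elem12]
      ext i j
      fin_cases i <;> fin_cases j <;> simp [Matrix.mul_apply, Fin.sum_univ_three, mul_comm]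
    rw [memH, ← map_mul, e, map_mul, map_mul, map_transvection_eq_one_of_dvd hρ _ (hb.mul_left t),
      mul_one, map_transvection_eq_of_dvd hρ _ t (by simpa [mul_sub] using hd.mul_left t)]
  have h20 : ∀ t : ℤ, elem20 t ∈ H := by
    intro t
    have e : elem20 t * cornerSL a b c d h =
        cornerSL a b c d h * (elem20 (t * a) * elem21 (t * b)) := by
      apply Subtype.ext
      simp only [Matrix.SpecialLinearGroup.coe_mul, coe_cornerSL, coe_elem20, coe_elem21]
      ext i j
      fin_cases i <;> fin_cases j <;> simp [Matrix.mul_apply, Fin.sum_univ_three]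
    rw [memH, ← map_mul ρ (elem20 t), e, map_mul, map_mul,
      map_transvection_eq_one_of_dvd hρ _ (hb.mul_left t), mul_one,
      map_transvection_eq_of_dvd hρ _ (s := t * a) t (by simpa [mul_sub] using ha.mul_left t)]
  have h21 : ∀ t : ℤ, elem21 t ∈ H := by
    intro t
    have e : elem21 t * cornerSL a b c d h =
        cornerSL a b c d h * (elem21 (t * d) * elem20 (t * c)) := by
      apply Subtype.ext
      simp only [Matrix.SpecialLinearGroup.coe_mul, coe_cornerSL, coe_elem20, coe_elem21]
      ext i j
      fin_cases i <;> fin_cases j <;> simp [Matrix.mul_apply, Fin.sum_univ_three]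
    rw [memH, ← map_mul ρ (elem21 t), e, map_mul, map_mul,
      map_transvection_eq_one_of_dvd hρ _ (hc.mul_left t), mul_one,
      map_transvection_eq_of_dvd hρ _ (s := t * d) t (by simpa [mul_sub] using hd.mul_left t)]
  have h01 : ∀ t : ℤ, elem01 t ∈ H := by
    intro t
    have e : elem01 t = elem02 t * elem21 1 * elem02 (-t) * elem21 (-1) := by
      apply Subtype.ext
      simp only [Matrix.SpecialLinearGroup.coe_mul, coe_elem01, coe_elem02, coe_elem21]
      ext i j
      fin_cases i <;> fin_cases j <;> simp [Matrix.mul_apply, Fin.sum_univ_three]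
    rw [e]
    exact mul_mem (mul_mem (mul_mem (h02 _) (h21 _)) (h02 _)) (h21 _)
  have h10 : ∀ t : ℤ, elem10 t ∈ H := by
    intro t
    have e : elem10 t = elem12 t * elem20 1 * elem12 (-t) * elem20 (-1) := by
      apply Subtype.ext
      simp only [Matrix.SpecialLinearGroup.coe_mul, coe_elem10, coe_elem12, coe_elem20]
      ext i j
      fin_cases i <;> fin_cases j <;> simp [Matrix.mul_apply, Fin.sum_univ_three]
    rw [e]
    exact mul_mem (mul_mem (mul_mem (h12 _) (h20 _)) (h12 _)) (h20 _)
  have hH : H = ⊤ := by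
    refine subgroup_SL_three_eq_top H fun i j hij t => ?_
    fin_cases i <;> fin_cases j <;>
      first
      | exact absurd rfl hij
      | exact h01 t
      | exact h02 t
      | exact h10 t
      | exact h12 t
      | exact h20 t
      | exact h21 t
  exact (memH g).1 (hH ▸ Subgroup.mem_top g)

/-- `IsCornerSymbol ρ m a b x` says that `x` is the image under `ρ` of a corner matrix with first
row `(a, b)` that is congruent to the identity modulo `m`. -/
def IsCornerSymbol (ρ : SpecialLinearGroup (Fin 3) ℤ →* Q) (m : ℕ) (a b : ℤ) (x : Q) : Prop :=
  ∃ (c d : ℤ) (h : a * d - b * c = 1), (m : ℤ) ∣ a - 1 ∧ (m : ℤ) ∣ b ∧ (m : ℤ) ∣ c ∧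
    (m : ℤ) ∣ d - 1 ∧ x = ρ (cornerSL a b c d h)

lemma map_cornerSL_eq
    (hρ : ∀ (i j : Fin 3) (hij : i ≠ j), ρ (Matrix.SpecialLinearGroup.transvection hij (m : ℤ)) = 1)
    {a b c d c' d' : ℤ} (h : a * d - b * c = 1) (h' : a * d' - b * c' = 1)
    (hc : (m : ℤ) ∣ c) (hc' : (m : ℤ) ∣ c') :
    ρ (cornerSL a b c d h) = ρ (cornerSL a b c' d' h') := by
  have e : cornerSL a b c d h = elem10 (c * d' - d * c') * cornerSL a b c' d' h' := by
    apply Subtype.ext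
    simp only [Matrix.SpecialLinearGroup.coe_mul, coe_cornerSL, coe_elem10]
    ext i j
    fin_cases i <;> fin_cases j <;> simp [Matrix.mul_apply, Fin.sum_univ_three]
    · linear_combination (-c) * h' + c' * h
    · linear_combination (-d) * h' + d' * h
  rw [e, map_mul, map_transvection_eq_one_of_dvd hρ _
    (dvd_sub (hc.mul_right _) (hc'.mul_left _)), one_mul]

lemma isMennickeSymbol_isCornerSymbol
    (hρ : ∀ (i j : Fin 3) (hij : i ≠ j),
      ρ (Matrix.SpecialLinearGroup.transvection hij (m : ℤ)) = 1) :
    IsMennickeSymbol m (IsCornerSymbol ρ m) where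
  isCoprime := by
    rintro a b x ⟨c, d, h, -⟩
    exact ⟨d, -c, by linear_combination h⟩
  dvd_sub_one := by
    rintro a b x ⟨c, d, h, ha, -⟩
    exact ha
  dvd := by
    rintro a b x ⟨c, d, h, -, hb, -⟩
    exact hb
  add_mul_left := by
    rintro a b x t ⟨c, d, h, ha, hb, hc, hd, rfl⟩
    have h' : (a + t * b) * (d - t * b) - b * (c + t * d - t * a - t ^ 2 * b) = 1 := by
      linear_combination h
    refine ⟨c + t * d - t * a - t ^ 2 * b, d - t * b, h', ?_, hb, ?_, ?_, ?_⟩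
    · rw [add_sub_right_comm]
      exact dvd_add ha (hb.mul_left t)
    · rw [show c + t * d - t * a - t ^ 2 * b = c + t * (d - 1) - t * (a - 1) - t ^ 2 * b by ring]
      exact dvd_sub (dvd_sub (dvd_add hc (hd.mul_left t)) (ha.mul_left t)) (hb.mul_left _)
    · rw [sub_right_comm]
      exact dvd_sub hd (hb.mul_left t)
    · have e : elem10 t * cornerSL _ _ _ _ h' = cornerSL a b c d h * elem10 t := by
        apply Subtype.ext
        simp only [Matrix.SpecialLinearGroup.coe_mul, coe_cornerSL, coe_elem10]
        ext i j
        fin_cases i <;> fin_cases j <;> simp [Matrix.mul_apply, Fin.sum_univ_three] <;> ring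
      have e' := congrArg ρ e
      rw [map_mul, map_mul, commute_map_cornerSL hρ h ha hb hc hd] at e'
      exact (mul_left_cancel e').symm
  add_mul_right := by
    rintro a b x t ⟨c, d, h, ha, hb, hc, hd, rfl⟩
    have h' : a * (d + t * (m * c)) - (b + t * (m * a)) * c = 1 := by linear_combination h
    refine ⟨c, d + t * (m * c), h', ha, ?_, hc, ?_, ?_⟩
    · exact dvd_add hb ((dvd_mul_right _ _).mul_left _)
    · rw [add_sub_right_comm]
      exact dvd_add hd ((dvd_mul_right _ _).mul_left _)
    · have e : cornerSL _ _ _ _ h' = cornerSL a b c d h * elem01 (m * t) := by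
        apply Subtype.ext
        simp only [Matrix.SpecialLinearGroup.coe_mul, coe_cornerSL, coe_elem01]
        ext i j
        fin_cases i <;> fin_cases j <;> simp [Matrix.mul_apply, Fin.sum_univ_three] <;> ring
      rw [e, map_mul, map_transvection_eq_one_of_dvd hρ _ (dvd_mul_right _ _), mul_one]
  neg_right := by
    rintro a b x ⟨c, d, h, ha, hb, hc, hd, rfl⟩
    have h' : a * d - -b * -c = 1 := by linear_combination h
    refine ⟨-c, d, h', ha, (dvd_neg).2 hb, (dvd_neg).2 hc, hd, ?_⟩
    let D : SpecialLinearGroup (Fin 3) ℤ :=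
      ⟨!![1, 0, 0; 0, -1, 0; 0, 0, -1], by simp [det_fin_three]⟩
    have hD : (D : Matrix (Fin 3) (Fin 3) ℤ) = !![1, 0, 0; 0, -1, 0; 0, 0, -1] := rfl
    have e : D * cornerSL _ _ _ _ h' = cornerSL a b c d h * D := by
      apply Subtype.ext
      simp only [Matrix.SpecialLinearGroup.coe_mul, coe_cornerSL, hD]
      ext i j
      fin_cases i <;> fin_cases j <;> simp [Matrix.mul_apply, Fin.sum_univ_three]
    have e' := congrArg ρ e
    rw [map_mul, map_mul, commute_map_cornerSL hρ h ha hb hc hd] at e'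
    exact (mul_left_cancel e').symm
  mul := by
    rintro a a' b x y ⟨c, d, h, ha, hb, hc, hd, rfl⟩ ⟨c', d', h', ha', -, hc', hd', rfl⟩
    have h'' : a * a' * (d * d') - b * (c' + d' * c * a') = 1 := by
      linear_combination a' * d' * h + h'
    refine ⟨_, _, h'', ?_, hb, ?_, ?_, ?_⟩
    · rw [show a * a' - 1 = a' * (a - 1) + (a' - 1) by ring]
      exact dvd_add (ha.mul_left _) ha'
    · exact dvd_add hc' ((hc.mul_left _).mul_right _)
    · rw [show d * d' - 1 = d' * (d - 1) + (d' - 1) by ring]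
      exact dvd_add (hd.mul_left _) hd'
    · let W : SpecialLinearGroup (Fin 3) ℤ :=
        ⟨!![1, 0, 0; 0, 0, -1; 0, 1, 0], by simp [det_fin_three]⟩
      have hW : (W : Matrix (Fin 3) (Fin 3) ℤ) = !![1, 0, 0; 0, 0, -1; 0, 1, 0] := rfl
      let B : SpecialLinearGroup (Fin 3) ℤ :=
        ⟨!![a', 0, b; 0, 1, 0; c', 0, d'], by simp [det_fin_three]; linear_combination h'⟩
      have hB : (B : Matrix (Fin 3) (Fin 3) ℤ) = !![a', 0, b; 0, 1, 0; c', 0, d'] := rfl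
      have eB : W * cornerSL _ _ _ _ h' = B * W := by
        apply Subtype.ext
        simp only [Matrix.SpecialLinearGroup.coe_mul, coe_cornerSL, hB, hW]
        ext i j
        fin_cases i <;> fin_cases j <;> simp [Matrix.mul_apply, Fin.sum_univ_three]
      have eW : elem21 1 * (elem12 (-1) * elem21 1) = W := by
        apply Subtype.ext
        simp only [Matrix.SpecialLinearGroup.coe_mul, coe_elem21, coe_elem12, hW]
        ext i j
        fin_cases i <;> fin_cases j <;> simp [Matrix.mul_apply, Fin.sum_univ_three]
      have e : elem21 d' * cornerSL a b c d h * B * elem12 (-a) * elem20 (c * a') * elem21 d =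
          W * cornerSL _ _ _ _ h'' := by
        apply Subtype.ext
        simp only [Matrix.SpecialLinearGroup.coe_mul, coe_elem21, coe_elem12, coe_elem20,
          coe_cornerSL,
          hB, hW]
        ext i j
        fin_cases i <;> fin_cases j <;> simp [Matrix.mul_apply, Fin.sum_univ_three]
        · exact Or.inl (by ring)
        · exact Or.inl (by ring)
        · ring
        · linear_combination (-(c * a')) * h
        · linear_combination (-d) * h
        · linear_combination -h
        · linear_combination (-(d' * c * a')) * h
        · linear_combination (-(d' * d)) * h
        · linear_combination (-d') * h
      have eB' : ρ B = ρ (cornerSL _ _ _ _ h') := by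
        have e' := congrArg ρ eB
        rw [map_mul, map_mul, ← commute_map_cornerSL hρ h' ha' hb hc' hd'] at e'
        exact (mul_right_cancel e').symm
      have e' := congrArg ρ e
      simp only [map_mul] at e'
      rw [eB', map_transvection_eq_one_of_dvd hρ _ (hc.mul_right a'), mul_one,
        map_transvection_eq_of_dvd hρ _ 1 hd, map_transvection_eq_of_dvd hρ _ 1 hd',
        map_transvection_eq_of_dvd hρ _ (s := -a) (-1)
          (by rw [neg_sub_neg, ← dvd_neg, neg_sub]; exact ha),
        mul_assoc, mul_assoc, mul_assoc, ← map_mul ρ (elem12 _),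
        commute_map_cornerSL hρ h' ha' hb hc' hd', ← mul_assoc (ρ (cornerSL _ _ _ _ h)),
        commute_map_cornerSL hρ h ha hb hc hd, mul_assoc, ← mul_assoc, ← map_mul,
        eW] at e'
      exact mul_left_cancel e'
  eq_one := by
    rintro b x ⟨c, d, h, ha, hb, hc, hd, rfl⟩
    have h' : (1 : ℤ) * 1 - b * 0 = 1 := by simp
    rw [map_cornerSL_eq hρ h h' hc (dvd_zero _)]
    have e : cornerSL 1 b 0 1 h' = elem01 b := by
      apply Subtype.ext
      rw [coe_elem01, coe_cornerSL]
    rw [e, map_transvection_eq_one_of_dvd hρ _ hb]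

end

/-- A normal subgroup of `SL₃(ℤ)` that contains the `m`-th powers of the elementary matrices
contains every corner matrix that is congruent to the identity modulo `m`. -/
theorem cornerSL_mem {m : ℕ} {N : Subgroup (SpecialLinearGroup (Fin 3) ℤ)} [N.Normal]
    (hN : ∀ (i j : Fin 3) (hij : i ≠ j), Matrix.SpecialLinearGroup.transvection hij (m : ℤ) ∈ N)
    {a b c d : ℤ} (h : a * d - b * c = 1) (ha : (m : ℤ) ∣ a - 1) (hb : (m : ℤ) ∣ b)
    (hc : (m : ℤ) ∣ c) (hd : (m : ℤ) ∣ d - 1) : cornerSL a b c d h ∈ N := by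
  have hρ : ∀ (i j : Fin 3) (hij : i ≠ j),
      QuotientGroup.mk' N (Matrix.SpecialLinearGroup.transvection hij (m : ℤ)) = 1 :=
    fun i j hij => (QuotientGroup.eq_one_iff _).2 (hN i j hij)
  have hS := isMennickeSymbol_isCornerSymbol hρ
  have hx : IsCornerSymbol (QuotientGroup.mk' N) m a b (QuotientGroup.mk' N (cornerSL a b c d h)) :=
    ⟨c, d, h, ha, hb, hc, hd, rfl⟩
  refine (QuotientGroup.eq_one_iff _).1 ?_
  rcases Nat.eq_zero_or_pos m with rfl | hm
  · obtain rfl : a = 1 := by simpa [sub_eq_zero] using ha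
    exact hS.eq_one hx
  · exact hS.eq_one_of_pos hm hx

section

variable {ι : Type*} [Fintype ι] [DecidableEq ι] {c : Finset ι} {m : ℕ}
  {N : Subgroup (SpecialLinearGroup ι ℤ)}

lemma IsElementaryStable.normal_comap_embedSL (hN : IsElementaryStable c m N) (f : Fin 3 ↪ ι)
    (hf : ∀ i, f i ∈ c) : (N.comap (embedSL f)).Normal := by
  have key : ∀ (i j : Fin 3) (hij : i ≠ j) (t : ℤ), ∀ g ∈ N.comap (embedSL f),
      Matrix.SpecialLinearGroup.transvection hij t * g *
        (Matrix.SpecialLinearGroup.transvection hij t)⁻¹ ∈ N.comap (embedSL f) := by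
    intro i j hij t g hg
    rw [Matrix.SpecialLinearGroup.transvection_inv, Subgroup.mem_comap, map_mul, map_mul,
      embedSL_transvection, embedSL_transvection]
    exact hN.conj_mem _ (hf i) (hf j) t _ hg
  rw [← Subgroup.normalizer_eq_top_iff]
  refine subgroup_SL_three_eq_top _ fun i j hij t => ?_
  rw [Subgroup.mem_normalizer_iff]
  refine fun g => ⟨key i j hij t g, fun h => ?_⟩
  have := key i j hij (-t) _ h
  rw [← Matrix.SpecialLinearGroup.transvection_inv] at this
  convert this using 1
  group

/-- A subgroup normalized by the elementary matrices with indices in a set `c` of at least three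
elements, and containing their `m`-th powers, contains every matrix supported on `c` and congruent
to the identity modulo `m`. -/
theorem IsElementaryStable.mem_of_three_le_card (hN : IsElementaryStable c m N)
    (hc : 3 ≤ c.card) {g : SpecialLinearGroup ι ℤ} (hg : g ∈ suppSubgroup c)
    (hgm : g ∈ congSubgroup ι m) : g ∈ N := by
  refine hN.mem_of_pairs (by omega) (fun i hi j hj hij g hg hgm => ?_) hg hgm
  obtain ⟨k, hk⟩ : ((c.erase i).erase j).Nonempty := by
    rw [← Finset.card_pos, Finset.card_erase_of_mem (Finset.mem_erase.2 ⟨hij.symm, hj⟩),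
      Finset.card_erase_of_mem hi]
    omega
  simp only [Finset.mem_erase] at hk
  obtain ⟨hkj, hki, hk⟩ := hk
  let f : Fin 3 ↪ ι := ⟨![i, j, k], by
    intro a b
    fin_cases a <;> fin_cases b <;> simp [hij, hij.symm, hkj, hkj.symm, hki, hki.symm]⟩
  have f0 : f 0 = i := rfl
  have f1 : f 1 = j := rfl
  have f2 : f 2 = k := rfl
  have hfc : ∀ a, f a ∈ c := by
    intro a
    fin_cases a
    exacts [hi, hj, hk]
  have hki' : k ∉ ({i, j} : Finset ι) := by simp [hki, hkj]
  have hrange : ∀ a ∈ ({i, j} : Finset ι), a ∈ Set.range f := by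
    intro a ha
    rcases Finset.mem_insert.1 ha with rfl | ha
    · exact ⟨0, rfl⟩
    · exact ⟨1, (Finset.mem_singleton.1 ha).symm⟩
  obtain ⟨M, hM, rfl⟩ := exists_embedSL_eq f (g := g)
    (fun a b hab => hg a b (hab.imp (mt (hrange a)) (mt (hrange b))))
  have e02 : M 0 2 = 0 := by
    rw [hM, f0, f2, hg _ _ (Or.inr hki'), Matrix.one_apply_ne hki.symm]
  have e12 : M 1 2 = 0 := by
    rw [hM, f1, f2, hg _ _ (Or.inr hki'), Matrix.one_apply_ne hkj.symm]
  have e20 : M 2 0 = 0 := by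
    rw [hM, f0, f2, hg _ _ (Or.inl hki'), Matrix.one_apply_ne hki]
  have e21 : M 2 1 = 0 := by
    rw [hM, f1, f2, hg _ _ (Or.inl hki'), Matrix.one_apply_ne hkj]
  have e22 : M 2 2 = 1 := by
    rw [hM, f2, hg _ _ (Or.inl hki'), Matrix.one_apply_eq]
  have hdet : M 0 0 * M 1 1 - M 0 1 * M 1 0 = 1 := by
    have h := M.2
    rw [Matrix.det_fin_three] at h
    change M 0 0 * M 1 1 * M 2 2 - M 0 0 * M 1 2 * M 2 1 - M 0 1 * M 1 0 * M 2 2 +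
      M 0 1 * M 1 2 * M 2 0 + M 0 2 * M 1 0 * M 2 1 - M 0 2 * M 1 1 * M 2 0 = 1 at h
    rw [e02, e12, e20, e22] at h
    linear_combination h
  have hcorner : M = cornerSL (M 0 0) (M 0 1) (M 1 0) (M 1 1) hdet := by
    apply Subtype.ext
    rw [coe_cornerSL]
    ext a b
    fin_cases a <;> fin_cases b <;> first | rfl | assumption
  have hcong := mem_congSubgroup.1 hgm
  have := hN.normal_comap_embedSL f hfc
  have hmem : M ∈ N.comap (embedSL f) := by
    rw [hcorner]
    refine cornerSL_mem (m := m) (fun a b hab => ?_) _ ?_ ?_ ?_ ?_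
    · rw [Subgroup.mem_comap, embedSL_transvection]
      exact hN.mem _ (hfc a) (hfc b)
    · simpa [hM, f0] using hcong i i
    · simpa [hM, f0, f1, hij] using hcong i j
    · simpa [hM, f0, f1, hij.symm] using hcong j i
    · simpa [hM, f1] using hcong j j
  exact hmem

end

section Triangular

variable {ι : Type*} [Fintype ι] {R : ι → ι → Prop}

open Classical in
/-- The equivalence class of `v` for the equivalence relation of a preorder. -/
noncomputable def relClass (R : ι → ι → Prop) (v : ι) : Finset ι :=
  Finset.univ.filter fun u => R u v ∧ R v u

lemma mem_relClass {u v : ι} : u ∈ relClass R v ↔ R u v ∧ R v u := by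
  simp [relClass]

variable [DecidableEq ι] {m : ℕ} {N : Subgroup (SpecialLinearGroup ι ℤ)}

/-- `N` contains the elementary matrices of level `m` with indices related by `R`, and is
normalized by all elementary matrices with indices related by `R`. -/
structure IsTriangularStable (R : ι → ι → Prop) (m : ℕ) (N : Subgroup (SpecialLinearGroup ι ℤ)) :
    Prop where
  mem : ∀ {i j : ι} (hij : i ≠ j), R i j → Matrix.SpecialLinearGroup.transvection hij (m : ℤ) ∈ N
  conj_mem : ∀ {i j : ι} (hij : i ≠ j), R i j → ∀ (t : ℤ), ∀ g ∈ N,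
    Matrix.SpecialLinearGroup.transvection hij t * g *
      Matrix.SpecialLinearGroup.transvection hij (-t) ∈ N

/-- `g` is block triangular with respect to `R`, and its diagonal blocks have determinant one. -/
structure IsBlockTriangular (R : ι → ι → Prop) (g : SpecialLinearGroup ι ℤ) : Prop where
  rel : ∀ i j, g i j ≠ 0 → R i j
  block : ∀ v, ∃ h ∈ suppSubgroup (relClass R v), ∀ i ∈ relClass R v, ∀ j ∈ relClass R v,
    h i j = g i j

namespace IsBlockTriangular

lemma one (hR : ∀ i, R i i) : IsBlockTriangular R 1 where
  rel i j h := by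
    by_cases hij : i = j
    · exact hij ▸ hR i
    · exact absurd (Matrix.one_apply_ne hij) h
  block v := ⟨1, one_mem _, fun i _ j _ => rfl⟩

lemma mul (hT : ∀ i j k, R i j → R j k → R i k) {g k : SpecialLinearGroup ι ℤ}
    (hg : IsBlockTriangular R g) (hk : IsBlockTriangular R k) : IsBlockTriangular R (g * k) where
  rel i j h := by
    rw [Matrix.SpecialLinearGroup.coe_mul, Matrix.mul_apply] at h
    obtain ⟨l, -, hl⟩ := Finset.exists_ne_zero_of_sum_ne_zero h
    exact hT i l j (hg.rel i l (left_ne_zero_of_mul hl)) (hk.rel l j (right_ne_zero_of_mul hl))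
  block v := by
    obtain ⟨x, hx, hxg⟩ := hg.block v
    obtain ⟨y, hy, hyk⟩ := hk.block v
    refine ⟨x * y, mul_mem hx hy, fun i hi j hj => ?_⟩
    rw [Matrix.SpecialLinearGroup.coe_mul, Matrix.SpecialLinearGroup.coe_mul, Matrix.mul_apply,
      Matrix.mul_apply]
    refine Finset.sum_congr rfl fun l _ => ?_
    by_cases hl : l ∈ relClass R v
    · rw [hxg i hi l hl, hyk l hl j hj]
    · rw [hx i l (Or.inr hl), Matrix.one_apply_ne (by rintro rfl; exact hl hi), zero_mul, eq_comm]
      by_contra h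
      have hil := hg.rel i l (left_ne_zero_of_mul h)
      have hlj := hk.rel l j (right_ne_zero_of_mul h)
      rw [mem_relClass] at hi hj
      exact hl (mem_relClass.2 ⟨hT _ _ _ hlj hj.1, hT _ _ _ hi.2 hil⟩)

lemma of_mem_suppSubgroup (hR : ∀ i, R i i) (hT : ∀ i j k, R i j → R j k → R i k)
    {g : SpecialLinearGroup ι ℤ} {v : ι} (hg : g ∈ suppSubgroup (relClass R v)) :
    IsBlockTriangular R g where
  rel i j h := by
    by_cases hij : i ∈ relClass R v ∧ j ∈ relClass R v
    · rw [mem_relClass, mem_relClass] at hij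
      exact hT _ _ _ hij.1.1 hij.2.2
    · rw [hg i j (not_and_or.1 hij)] at h
      exact (one hR).rel i j h
  block w := by
    by_cases hw : R v w ∧ R w v
    · have : relClass R v = relClass R w := by
        ext a
        rw [mem_relClass, mem_relClass]
        exact ⟨fun h => ⟨hT _ _ _ h.1 hw.1, hT _ _ _ hw.2 h.2⟩,
          fun h => ⟨hT _ _ _ h.1 hw.2, hT _ _ _ hw.1 h.2⟩⟩
      exact ⟨g, this ▸ hg, fun i _ j _ => rfl⟩
    · refine ⟨1, one_mem _, fun i hi j _ => ?_⟩
      rw [hg i j (Or.inl fun h => hw ?_), Matrix.SpecialLinearGroup.coe_one]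
      rw [mem_relClass] at hi h
      exact ⟨hT _ _ _ h.2 hi.1, hT _ _ _ hi.2 h.1⟩

lemma transvection (hR : ∀ i, R i i) (hT : ∀ i j k, R i j → R j k → R i k) {i j : ι}
    (hij : i ≠ j) (h : R i j) (t : ℤ) :
    IsBlockTriangular R (Matrix.SpecialLinearGroup.transvection hij t) := by
  by_cases h' : R j i
  · exact of_mem_suppSubgroup hR hT (v := i) (transvection_mem_suppSubgroup hij
      (mem_relClass.2 ⟨hR i, hR i⟩) (mem_relClass.2 ⟨h', h⟩) t)
  · refine ⟨fun a b hab => ?_, fun v => ⟨1, one_mem _, fun a ha b hb => ?_⟩⟩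
    · rw [transvection_apply] at hab
      split_ifs at hab with hab'
      · rwa [hab'.1, hab'.2]
      · exact (one hR).rel a b (by simpa using hab)
    · rw [transvection_apply, if_neg, add_zero, Matrix.SpecialLinearGroup.coe_one]
      rintro ⟨rfl, rfl⟩
      rw [mem_relClass] at ha hb
      exact h' (hT _ _ _ hb.1 ha.2)

lemma of_mem_closure (hR : ∀ i, R i i) (hT : ∀ i j k, R i j → R j k → R i k)
    {g : SpecialLinearGroup ι ℤ} (hg : g ∈ Subgroup.closure {x | ∃ (i j : ι) (hij : i ≠ j) (t : ℤ),
      R i j ∧ x = Matrix.SpecialLinearGroup.transvection hij t}) : IsBlockTriangular R g := by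
  induction hg using Subgroup.closure_induction_left with
  | one => exact one hR
  | mul_left x hx y _ ih =>
    obtain ⟨i, j, hij, t, h, rfl⟩ := hx
    exact (transvection hR hT hij h t).mul hT ih
  | inv_mul_cancel x hx y _ ih =>
    obtain ⟨i, j, hij, t, h, rfl⟩ := hx
    rw [Matrix.SpecialLinearGroup.transvection_inv]
    exact (transvection hR hT hij h _).mul hT ih

end IsBlockTriangular

namespace IsTriangularStable

lemma isElementaryStable (hN : IsTriangularStable R m N) (hT : ∀ i j k, R i j → R j k → R i k)
    (v : ι) : IsElementaryStable (relClass R v) m N where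
  mem hij hi hj := hN.mem hij (hT _ _ _ (mem_relClass.1 hi).1 (mem_relClass.1 hj).2)
  conj_mem hij hi hj := hN.conj_mem hij (hT _ _ _ (mem_relClass.1 hi).1 (mem_relClass.1 hj).2)

lemma mem_of_suppSubgroup (hN : IsTriangularStable R m N) (hR : ∀ i, R i i)
    (hT : ∀ i j k, R i j → R j k → R i k) {v : ι} (hv : (relClass R v).card ≠ 2)
    {g : SpecialLinearGroup ι ℤ} (hg : g ∈ suppSubgroup (relClass R v))
    (hgm : g ∈ congSubgroup ι m) : g ∈ N := by
  have hvv : v ∈ relClass R v := mem_relClass.2 ⟨hR v, hR v⟩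
  by_cases h3 : 3 ≤ (relClass R v).card
  · exact (hN.isElementaryStable hT v).mem_of_three_le_card h3 hg hgm
  · obtain ⟨w, hw⟩ : ∃ w, relClass R v = {w} := by
      rw [← Finset.card_eq_one]
      have := Finset.card_pos.2 ⟨v, hvv⟩
      omega
    rw [hw] at hg
    let f : Fin 1 ↪ ι := ⟨fun _ => w, fun _ _ _ => Subsingleton.elim _ _⟩
    obtain ⟨M, -, rfl⟩ := exists_embedSL_eq f (g := g) fun a b hab => hg a b
      (hab.imp (fun h ha => h ⟨0, (Finset.mem_singleton.1 ha).symm⟩)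
        (fun h ha => h ⟨0, (Finset.mem_singleton.1 ha).symm⟩))
    rw [Subsingleton.elim M 1, map_one]
    exact one_mem N

lemma mem_of_dvd (hN : IsTriangularStable R m N) {i j : ι} (hij : i ≠ j) (h : R i j) {t : ℤ}
    (ht : (m : ℤ) ∣ t) : Matrix.SpecialLinearGroup.transvection hij t ∈ N := by
  obtain ⟨k, rfl⟩ := ht
  rw [transvection_mul_eq_zpow]
  exact zpow_mem (hN.mem hij h) k

/-- The case of matrices all of whose diagonal blocks are trivial. -/
lemma mem_of_unitriangular (hN : IsTriangularStable R m N) (hR : ∀ i, R i i)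
    (hT : ∀ i j k, R i j → R j k → R i k) {g : SpecialLinearGroup ι ℤ}
    (hg : ∀ i j, g i j ≠ 0 → R i j) (hg' : ∀ i j, R i j → R j i → g i j = (1 : Matrix ι ι ℤ) i j)
    (hgm : g ∈ congSubgroup ι m) : g ∈ N := by
  classical
  induction hn : (Finset.univ.filter fun p : ι × ι => p.1 ≠ p.2 ∧ g p.1 p.2 ≠ 0).card using
    Nat.strong_induction_on generalizing g with
  | _ n ih =>
  let bad : Finset ι := Finset.univ.filter fun v => ∃ w, v ≠ w ∧ g v w ≠ 0
  by_cases hbad : bad.Nonempty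
  · obtain ⟨v, hv, hmin⟩ := bad.exists_min_image
      (fun v => (Finset.univ.filter fun w => R v w).card) hbad
    obtain ⟨w, hvw, hw⟩ := (Finset.mem_filter.1 hv).2
    have hRvw := hg v w hw
    have hRwv : ¬ R w v := by
      intro h
      rw [hg' v w hRvw h, Matrix.one_apply_ne hvw] at hw
      exact hw rfl
    have hrow : ∀ j, g w j = (1 : Matrix ι ι ℤ) w j := by
      intro j
      by_cases hwj : w = j
      · rw [← hwj]
        exact hg' w w (hR w) (hR w)
      · rw [Matrix.one_apply_ne hwj]
        by_contra h
        refine (hmin w (Finset.mem_filter.2 ⟨Finset.mem_univ _, j, hwj, h⟩)).not_gt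
          (Finset.card_lt_card ?_)
        rw [Finset.ssubset_iff_of_subset]
        · exact ⟨v, by simpa using hR v, by simpa using hRwv⟩
        · intro x
          simpa using hT v w x hRvw
    set g₁ := Matrix.SpecialLinearGroup.transvection hvw (-g v w) * g with hg₁
    have hdvd : (m : ℤ) ∣ -g v w := by
      rw [dvd_neg]
      simpa [Matrix.one_apply_ne hvw] using mem_congSubgroup.1 hgm v w
    have e : ∀ i j, g₁ i j = if i = v ∧ j = w then 0 else g i j := by
      intro i j
      rw [hg₁, transvection_mul_apply, hrow]
      by_cases hi : i = v
      · by_cases hj : j = w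
        · subst hi hj
          simp
        · simp [hi, hj, Matrix.one_apply_ne (Ne.symm hj)]
      · simp [hi]
    have h₁ : g₁ ∈ N := by
      refine ih _ ?_ (fun i j hij => ?_) (fun i j hij hji => ?_)
        (mul_mem (transvection_mem_congSubgroup hvw hdvd) hgm) rfl
      · rw [← hn]
        refine Finset.card_lt_card ?_
        rw [Finset.ssubset_iff_of_subset]
        · exact ⟨(v, w), by simp [hvw, hw], by simp [e]⟩
        · rintro ⟨i, j⟩
          simp only [Finset.mem_filter, Finset.mem_univ, true_and, e]
          split_ifs <;> simp_all
      · rw [e] at hij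
        split_ifs at hij
        · exact absurd rfl hij
        · exact hg i j hij
      · rw [e, if_neg, hg' i j hij hji]
        rintro ⟨rfl, rfl⟩
        exact hRwv hji
    exact (Subgroup.mul_mem_cancel_left _ (hN.mem_of_dvd hvw hRvw hdvd)).1 h₁
  · have : g = 1 := by
      ext i j
      by_cases hij : i = j
      · exact hij ▸ hg' i i (hR i) (hR i)
      · rw [Matrix.SpecialLinearGroup.coe_one, Matrix.one_apply_ne hij]
        by_contra h
        exact hbad ⟨i, Finset.mem_filter.2 ⟨Finset.mem_univ _, j, hij, h⟩⟩
    rw [this]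
    exact one_mem N

/-- The matrices generated by the elementary matrices with indices related by `R` that are
congruent to the identity modulo `m` belong to `N`, provided no equivalence class of `R` has two
elements. -/
theorem mem_of_mem_closure (hN : IsTriangularStable R m N) (hR : ∀ i, R i i)
    (hT : ∀ i j k, R i j → R j k → R i k) (hcl : ∀ v, (relClass R v).card ≠ 2)
    {g : SpecialLinearGroup ι ℤ} (hg : g ∈ Subgroup.closure {x | ∃ (i j : ι) (hij : i ≠ j) (t : ℤ),
      R i j ∧ x = Matrix.SpecialLinearGroup.transvection hij t}) (hgm : g ∈ congSubgroup ι m) :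
    g ∈ N := by
  have key : ∀ u : Finset ι, ∃ g', IsBlockTriangular R g' ∧ g' ∈ congSubgroup ι m ∧
      (g' ∈ N → g ∈ N) ∧ ∀ v ∈ u, ∀ i ∈ relClass R v, ∀ j ∈ relClass R v,
        g' i j = (1 : Matrix ι ι ℤ) i j := by
    intro u
    induction u using Finset.induction_on with
    | empty => exact ⟨g, .of_mem_closure hR hT hg, hgm, id, by simp⟩
    | insert v u _ ih =>
      obtain ⟨g', htri, hcong, hmem, hblock⟩ := ih
      obtain ⟨h, hsupp, hh⟩ := htri.block v
      have hhm : h ∈ congSubgroup ι m := by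
        refine mem_congSubgroup.2 fun i j => ?_
        by_cases hij : i ∈ relClass R v ∧ j ∈ relClass R v
        · rw [hh i hij.1 j hij.2]
          exact mem_congSubgroup.1 hcong i j
        · rw [hsupp i j (not_and_or.1 hij), sub_self]
          exact dvd_zero _
      have hhN : h ∈ N := hN.mem_of_suppSubgroup hR hT (hcl v) hsupp hhm
      have hsupp' := inv_mem hsupp
      refine ⟨g' * h⁻¹, htri.mul hT (.of_mem_suppSubgroup hR hT hsupp'),
        mul_mem hcong (inv_mem hhm),
        fun h' => hmem ((Subgroup.mul_mem_cancel_right _ (inv_mem hhN)).1 h'), ?_⟩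
      intro w hw i hi j hj
      by_cases hjv : j ∈ relClass R v
      · have hiv : i ∈ relClass R v := by
          rw [mem_relClass] at hi hj hjv ⊢
          exact ⟨hT _ _ _ hi.1 (hT _ _ _ hj.2 hjv.1), hT _ _ _ hjv.2 (hT _ _ _ hj.1 hi.2)⟩
        rw [← Matrix.SpecialLinearGroup.coe_one, ← mul_inv_cancel h,
          Matrix.SpecialLinearGroup.coe_mul, Matrix.SpecialLinearGroup.coe_mul, Matrix.mul_apply,
          Matrix.mul_apply]
        refine Finset.sum_congr rfl fun l _ => ?_
        by_cases hl : l ∈ relClass R v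
        · rw [hh i hiv l hl]
        · rw [hsupp' l j (Or.inl hl), Matrix.one_apply_ne (by rintro rfl; exact hl hjv), mul_zero,
            mul_zero]
      · have hwu : w ∈ u := by
          refine (Finset.mem_insert.1 hw).resolve_left ?_
          rintro rfl
          exact hjv hj
        rw [Matrix.SpecialLinearGroup.coe_mul, Matrix.mul_apply,
          Finset.sum_congr rfl fun l _ => by rw [hsupp' l j (Or.inr hjv)]]
        simpa [Matrix.one_apply] using hblock w hwu i hi j hj
  obtain ⟨g', htri, hcong, hmem, hblock⟩ := key Finset.univ
  refine hmem (hN.mem_of_unitriangular hR hT htri.rel (fun i j hij hji => ?_) hcong)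
  exact hblock i (Finset.mem_univ i) i (mem_relClass.2 ⟨hR i, hR i⟩) j (mem_relClass.2 ⟨hji, hij⟩)

end IsTriangularStable

end Triangular

end Congruence

section Linear

set_option linter.unusedSectionVars false

variable {Γ : SimpleGraph V} {m : ℕ}

/-- The exponent sums of an element of `Raag Γ`. -/
def expSum (Γ : SimpleGraph V) : Raag Γ →* Multiplicative (V → ℤ) :=
  PresentedGroup.toGroup (f := fun v => Multiplicative.ofAdd (Pi.single v 1)) (by
    rintro r ⟨u, v, -, rfl⟩
    simp only [map_mul, map_inv, FreeGroup.lift_apply_of]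
    rw [mul_inv_eq_one, mul_inv_eq_iff_eq_mul, mul_comm])

lemma expSum_gen (v : V) : expSum Γ (gen Γ v) = Multiplicative.ofAdd (Pi.single v 1) :=
  PresentedGroup.toGroup.of _

lemma hom_ext_gen {G : Type*} [Group G] {f g : Raag Γ →* G}
    (h : ∀ v, f (gen Γ v) = g (gen Γ v)) : f = g :=
  PresentedGroup.ext h

/-- The element of the abelianization with given exponent sums. -/
def ofExpSum (Γ : SimpleGraph V) : Multiplicative (V → ℤ) →* Abelianization (Raag Γ) where
  toFun x := ∏ v, Abelianization.of (gen Γ v) ^ x.toAdd v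
  map_one' := by simp
  map_mul' x y := by simp [zpow_add, Finset.prod_mul_distrib]

lemma ofExpSum_expSum (y : Raag Γ) : ofExpSum Γ (expSum Γ y) = Abelianization.of y := by
  have : (ofExpSum Γ).comp (expSum Γ) = Abelianization.of := by
    refine hom_ext_gen fun v => ?_
    rw [MonoidHom.comp_apply, expSum_gen]
    change ∏ u, Abelianization.of (gen Γ u) ^ (Pi.single v (1 : ℤ) : V → ℤ) u = _
    rw [Finset.prod_eq_single v] <;> simp +contextual
  exact DFunLike.congr_fun this y

/-- The matrix of an automorphism acting on the abelianization. -/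
def abMatrix (α : MulAut (Raag Γ)) : Matrix V V ℤ :=
  Matrix.of fun w v => (expSum Γ (α (gen Γ v))).toAdd w

lemma abMatrix_apply (α : MulAut (Raag Γ)) (w v : V) :
    abMatrix α w v = (expSum Γ (α (gen Γ v))).toAdd w := rfl

lemma expSum_apply (α : MulAut (Raag Γ)) (x : Raag Γ) :
    (expSum Γ (α x)).toAdd = (abMatrix α).mulVec (expSum Γ x).toAdd := by
  have : (expSum Γ).comp α.toMonoidHom =
      (AddMonoidHom.toMultiplicative (abMatrix α).mulVecLin.toAddMonoidHom).comp (expSum Γ) := by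
    refine hom_ext_gen fun v => ?_
    rw [MonoidHom.comp_apply, MonoidHom.comp_apply, expSum_gen]
    change expSum Γ (α (gen Γ v)) =
      Multiplicative.ofAdd ((abMatrix α).mulVec (Pi.single v (1 : ℤ)))
    rw [Matrix.mulVec_single_one]
    rfl
  exact congrArg Multiplicative.toAdd (DFunLike.congr_fun this x)

/-- The action on the abelianization as a homomorphism to matrices. -/
def abMatrixHom (Γ : SimpleGraph V) : MulAut (Raag Γ) →* Matrix V V ℤ where
  toFun := abMatrix
  map_one' := by
    ext w v
    rw [abMatrix_apply, MulAut.one_apply, expSum_gen]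
    simp [Matrix.one_apply, Pi.single_apply]
  map_mul' α β := by
    ext w v
    rw [abMatrix_apply, MulAut.mul_apply, expSum_apply]
    rfl

/-- The action on the abelianization as a homomorphism to the general linear group. -/
def abGL (Γ : SimpleGraph V) : MulAut (Raag Γ) →* GL V ℤ := (abMatrixHom Γ).toHomUnits

lemma coe_abGL (α : MulAut (Raag Γ)) : (abGL Γ α : Matrix V V ℤ) = abMatrix α := rfl

lemma abAutHom_of (α : MulAut (Raag Γ)) (y : Raag Γ) :
    abAutHom Γ α (Abelianization.of y) = Abelianization.of (α y) := rfl

lemma mem_IA_of_abGL_eq_one {α : MulAut (Raag Γ)} (h : abGL Γ α = 1) : α ∈ IA Γ := by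
  have hα : abMatrix α = 1 := by rw [← coe_abGL, h, Units.val_one]
  refine MulEquiv.ext fun x => ?_
  obtain ⟨y, rfl : Abelianization.of y = x⟩ := QuotientGroup.mk_surjective x
  rw [abAutHom_of, ← ofExpSum_expSum, MulAut.one_apply, ← ofExpSum_expSum]
  refine congrArg _ (Multiplicative.toAdd.injective ?_)
  rw [expSum_apply, hα, Matrix.one_mulVec]

lemma dvd_of_mem_IAm {α : MulAut (Raag Γ)} (h : α ∈ IAm Γ m) (w v : V) :
    (m : ℤ) ∣ abMatrix α w v - (1 : Matrix V V ℤ) w v := by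
  obtain ⟨z, hz⟩ := h (Abelianization.of (gen Γ v))
  have := congrArg (fun x => (Abelianization.lift (expSum Γ) x).toAdd w) hz
  simp only [powMonoidHom_apply, map_pow, toAdd_pow, Pi.smul_apply, abAutHom_of, map_mul, map_inv,
    toAdd_mul, toAdd_inv, Pi.add_apply, Pi.neg_apply, Abelianization.lift_apply_of,
    expSum_gen, toAdd_ofAdd, nsmul_eq_mul, ← abMatrix_apply] at this
  refine ⟨_, Eq.trans ?_ this.symm⟩
  simp [Matrix.one_apply, Pi.single_apply, sub_eq_add_neg]

lemma mem_IAm_of_dvd {α : MulAut (Raag Γ)}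
    (h : ∀ w v, (m : ℤ) ∣ abMatrix α w v - (1 : Matrix V V ℤ) w v) : α ∈ IAm Γ m := by
  choose M hM using h
  intro x
  obtain ⟨y, rfl : Abelianization.of y = x⟩ := QuotientGroup.mk_surjective x
  refine ⟨ofExpSum Γ (Multiplicative.ofAdd ((Matrix.of M).mulVec (expSum Γ y).toAdd)), ?_⟩
  have hM' : abMatrix α = 1 + (m : ℤ) • Matrix.of M := by
    ext w v
    have := hM w v
    simp only [Matrix.add_apply, Matrix.smul_apply, Matrix.of_apply, smul_eq_mul]
    linarith
  rw [abAutHom_of, powMonoidHom_apply, ← map_pow, ← ofExpSum_expSum, ← ofExpSum_expSum,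
    ← map_inv, ← map_mul]
  refine congrArg _ (Multiplicative.toAdd.injective ?_)
  rw [toAdd_mul, toAdd_inv, expSum_apply, hM', toAdd_pow, toAdd_ofAdd, Matrix.add_mulVec,
    Matrix.one_mulVec, Matrix.smul_mulVec, natCast_zsmul]
  abel

instance normal_IAm (Γ : SimpleGraph V) (m : ℕ) : (IAm Γ m).Normal where
  conj_mem α hα g x := by
    obtain ⟨z, hz⟩ := hα (abAutHom Γ g⁻¹ x)
    refine ⟨abAutHom Γ g z, ?_⟩
    have hx : abAutHom Γ g (abAutHom Γ g⁻¹ x) = x := by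
      rw [← MulAut.mul_apply, ← map_mul, mul_inv_cancel, map_one, MulAut.one_apply]
    rw [powMonoidHom_apply] at hz ⊢
    rw [← map_pow, hz, map_mul (abAutHom Γ g), map_inv (abAutHom Γ g), hx, map_mul (abAutHom Γ),
      map_mul (abAutHom Γ), MulAut.mul_apply, MulAut.mul_apply]

lemma IA_le_IAm (Γ : SimpleGraph V) (m : ℕ) : IA Γ ≤ IAm Γ m := by
  intro α hα x
  rw [MonoidHom.mem_ker.1 hα, MulAut.one_apply, mul_inv_cancel]
  exact one_mem _

end Linear

section Transvections

set_option linter.unusedSectionVars false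

variable {Γ : SimpleGraph V} {v w : V}

lemma Le.refl (v : V) : Le Γ v v := Set.subset_insert _ _

lemma Le.trans {u v w : V} (huv : Le Γ u v) (hvw : Le Γ v w) : Le Γ u w := by
  intro x hx
  rcases huv hx with rfl | hxv
  · by_cases huw : u = w
    · subst huw
      exact Or.inr hx
    · have : u ∈ lk Γ x := hx.symm
      rcases hvw this with rfl | h
      · exact absurd rfl huw
      · have : w ∈ lk Γ u := h.symm
        rcases huv this with rfl | h'
        · exact Or.inl rfl
        · exact Or.inr (h'.symm)
  · exact hvw hxv

lemma commute_gen {u v : V} (h : Γ.Adj u v) : Commute (gen Γ u) (gen Γ v) := by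
  have : (QuotientGroup.mk (FreeGroup.of u * FreeGroup.of v * (FreeGroup.of u)⁻¹ *
      (FreeGroup.of v)⁻¹) : Raag Γ) = 1 :=
    PresentedGroup.one_of_mem ⟨u, v, h, rfl⟩
  have h' : gen Γ u * gen Γ v * (gen Γ u)⁻¹ * (gen Γ v)⁻¹ = 1 := this
  rw [mul_inv_eq_one, mul_inv_eq_iff_eq_mul] at h'
  exact h'

/-- The endomorphism of `Raag Γ` multiplying `v` by `w ^ s`. -/
def transvectionHom (hvw : Le Γ v w) (s : ℤ) : Raag Γ →* Raag Γ :=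
  PresentedGroup.toGroup
    (f := fun z => if z = v then gen Γ v * gen Γ w ^ s else gen Γ z) (by
    have key : ∀ b, Γ.Adj v b → Commute (gen Γ v * gen Γ w ^ s) (gen Γ b) := by
      intro b hb
      refine (commute_gen hb).mul_left (Commute.zpow_left ?_ s)
      rcases hvw hb with rfl | h
      · exact Commute.refl _
      · exact commute_gen h
    rintro r ⟨a, b, hab, rfl⟩
    simp only [map_mul, map_inv, FreeGroup.lift_apply_of]
    rw [mul_inv_eq_one, mul_inv_eq_iff_eq_mul]
    split_ifs with ha hb hb
    · rfl
    · exact key b (ha ▸ hab)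
    · exact (key a (hb ▸ hab.symm)).symm
    · exact commute_gen hab)

lemma transvectionHom_gen (hvw : Le Γ v w) (s : ℤ) (z : V) : transvectionHom hvw s (gen Γ z) =
    if z = v then gen Γ v * gen Γ w ^ s else gen Γ z :=
  PresentedGroup.toGroup.of _

lemma transvectionHom_comp (hvw : Le Γ v w) (hne : v ≠ w) {s t : ℤ} (hst : s + t = 0) :
    (transvectionHom hvw s).comp (transvectionHom hvw t) = MonoidHom.id _ := by
  refine hom_ext_gen fun z => ?_
  rw [MonoidHom.comp_apply, transvectionHom_gen]
  split_ifs with h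
  · rw [map_mul, map_zpow, transvectionHom_gen, transvectionHom_gen, if_pos rfl,
      if_neg hne.symm, mul_assoc, ← zpow_add, hst, zpow_zero, mul_one, h, MonoidHom.id_apply]
  · rw [transvectionHom_gen, if_neg h, MonoidHom.id_apply]

lemma exists_isTransvection (hvw : Le Γ v w) (hne : v ≠ w) : ∃ α : MulAut (Raag Γ),
    α (gen Γ v) = gen Γ v * gen Γ w ∧ ∀ z : V, z ≠ v → α (gen Γ z) = gen Γ z := by
  refine ⟨MonoidHom.toMulEquiv (transvectionHom hvw 1) (transvectionHom hvw (-1))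
    (transvectionHom_comp hvw hne (by norm_num)) (transvectionHom_comp hvw hne (by norm_num)),
    ?_, fun z hz => ?_⟩
  · rw [MonoidHom.toMulEquiv_apply, transvectionHom_gen, if_pos rfl, zpow_one]
  · rw [MonoidHom.toMulEquiv_apply, transvectionHom_gen, if_neg hz]

lemma abGL_transvection (hne : w ≠ v) {α : MulAut (Raag Γ)}
    (hv : α (gen Γ v) = gen Γ v * gen Γ w) (hz : ∀ z : V, z ≠ v → α (gen Γ z) = gen Γ z) :
    abGL Γ α = Matrix.SpecialLinearGroup.toGL (Matrix.SpecialLinearGroup.transvection hne 1) := by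
  refine Units.ext (Matrix.ext fun a b => ?_)
  rw [coe_abGL, abMatrix_apply, Matrix.SpecialLinearGroup.coe_GL_coe_matrix, transvection_apply]
  by_cases hb : b = v
  · subst hb
    rw [hv, map_mul, expSum_gen, expSum_gen]
    simp [Matrix.one_apply, Pi.single_apply]
  · rw [hz b hb, expSum_gen]
    simp [Matrix.one_apply, Pi.single_apply, hb]

lemma abGL_isPartialConj {α : MulAut (Raag Γ)} (hα : IsPartialConj Γ α) : abGL Γ α = 1 := by
  obtain ⟨v, Y, -, hY, hY'⟩ := hα
  rw [← map_one (abGL Γ)]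
  refine Units.ext (Matrix.ext fun a b => ?_)
  rw [coe_abGL, coe_abGL, abMatrix_apply, abMatrix_apply, MulAut.one_apply]
  by_cases hb : b ∈ Y
  · rw [hY b hb, map_mul (expSum Γ), map_mul (expSum Γ), map_inv (expSum Γ), mul_comm,
      mul_inv_cancel_left]
  · rw [hY' b hb]

lemma transvection_eq_zpow {ι : Type*} [Fintype ι] [DecidableEq ι] {i j : ι} (hij : i ≠ j)
    (k : ℤ) : Matrix.SpecialLinearGroup.transvection hij k =
      Matrix.SpecialLinearGroup.transvection hij 1 ^ k := by
  rw [← transvection_mul_eq_zpow, one_mul]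

lemma exists_SAut0_abGL (hvw : Le Γ v w) (hne : w ≠ v) : ∃ τ : SAut0 Γ,
    IsTransvection Γ τ ∧ ∀ k : ℤ, abGL Γ ((τ : MulAut (Raag Γ)) ^ k) =
      Matrix.SpecialLinearGroup.toGL (Matrix.SpecialLinearGroup.transvection hne k) := by
  obtain ⟨α, hv, hz⟩ := exists_isTransvection hvw hne.symm
  have hα : IsTransvection Γ α := ⟨v, w, hne.symm, hvw, hv, hz⟩
  refine ⟨⟨α, Subgroup.subset_closure (Or.inl hα)⟩, hα, fun k => ?_⟩
  rw [map_zpow, abGL_transvection hne hv hz, ← map_zpow, ← transvection_eq_zpow]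

lemma pow_mem_IAm {t : MulAut (Raag Γ)} (ht : IsTransvection Γ t) (m : ℕ) : t ^ m ∈ IAm Γ m := by
  obtain ⟨v, w, hne, -, hv, hz⟩ := ht
  refine mem_IAm_of_dvd ?_
  rw [← coe_abGL, map_pow, abGL_transvection hne.symm hv hz, ← map_pow, ← zpow_natCast,
    ← transvection_eq_zpow]
  exact mem_congSubgroup.1 (transvection_mem_congSubgroup hne.symm dvd_rfl)

lemma SAut0_le (Γ : SimpleGraph V) : SAut0 Γ ≤ ((Subgroup.closure
    {x : Matrix.SpecialLinearGroup V ℤ | ∃ (i j : V) (hij : i ≠ j) (t : ℤ), Le Γ j i ∧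
      x = Matrix.SpecialLinearGroup.transvection hij t}).map
        Matrix.SpecialLinearGroup.toGL).comap (abGL Γ) := by
  refine (Subgroup.closure_le _).2 ?_
  rintro α (⟨v, w, hne, hvw, hv, hz⟩ | hα)
  · exact ⟨_, Subgroup.subset_closure ⟨w, v, hne.symm, 1, hvw, rfl⟩,
      (abGL_transvection hne.symm hv hz).symm⟩
  · refine ⟨1, one_mem _, ?_⟩
    rw [abGL_isPartialConj hα, map_one]

end Transvections

theorem SIA_eq_normalClosure (Γ : SimpleGraph V)
    (hcl : ∀ v : V, (simClass Γ v).ncard ≠ 2) (m : ℕ) :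
    (SIA Γ m).subgroupOf (SAut0 Γ) =
      Subgroup.normalClosure
        {g : SAut0 Γ | (↑g : MulAut (Raag Γ)) ∈ IA Γ ∨
          ∃ t : MulAut (Raag Γ), IsTransvection Γ t ∧ (↑g : MulAut (Raag Γ)) = t ^ m} := by
  have hSIA : (SIA Γ m).subgroupOf (SAut0 Γ) = (IAm Γ m).subgroupOf (SAut0 Γ) := by
    rw [SIA, Subgroup.inf_subgroupOf_left]
  rw [hSIA]
  set S := {g : SAut0 Γ | (↑g : MulAut (Raag Γ)) ∈ IA Γ ∨
    ∃ t : MulAut (Raag Γ), IsTransvection Γ t ∧ (↑g : MulAut (Raag Γ)) = t ^ m}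
  refine le_antisymm (fun g hg => ?_) (Subgroup.normalClosure_le_normal ?_)
  · set ψ : SAut0 Γ →* GL V ℤ := (abGL Γ).comp (SAut0 Γ).subtype
    have hN : IsTriangularStable (fun i j => Le Γ j i) m
        (((Subgroup.normalClosure S).map ψ).comap Matrix.SpecialLinearGroup.toGL) := by
      refine ⟨fun {i j} hij h => ?_, fun {i j} hij h t x hx => ?_⟩
      · obtain ⟨τ, hτ, hτk⟩ := exists_SAut0_abGL h hij
        refine ⟨τ ^ m, Subgroup.subset_normalClosure (Or.inr ⟨τ, hτ, rfl⟩), ?_⟩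
        rw [← hτk, zpow_natCast]
        rfl
      · obtain ⟨τ, hτ, hτk⟩ := exists_SAut0_abGL h hij
        obtain ⟨k, hk, hkx⟩ := hx
        refine ⟨_, Subgroup.normalClosure_normal.conj_mem k hk (τ ^ t), ?_⟩
        rw [map_mul, map_mul, map_mul, map_mul, hkx, ← hτk, ← hτk, zpow_neg]
        rfl
    obtain ⟨M, hM, hMg⟩ := SAut0_le Γ g.2
    have hMm : M ∈ congSubgroup V m := by
      refine mem_congSubgroup.2 fun i j => ?_
      rw [← Matrix.SpecialLinearGroup.coe_GL_coe_matrix, hMg]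
      exact dvd_of_mem_IAm hg i j
    have hcard : ∀ v, (relClass (fun i j => Le Γ j i) v).card ≠ 2 := by
      intro v
      rw [← Set.ncard_coe_finset]
      convert hcl v using 2
      ext u
      rw [Finset.mem_coe, mem_relClass]
      exact and_comm
    obtain ⟨k, hk, hkM⟩ := hN.mem_of_mem_closure (fun i => Le.refl i)
      (fun i j k hij hjk => hjk.trans hij) hcard hM hMm
    have hgk : g * k⁻¹ ∈ Subgroup.normalClosure S := by
      refine Subgroup.subset_normalClosure (Or.inl (mem_IA_of_abGL_eq_one ?_))
      change ψ (g * k⁻¹) = 1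
      rw [map_mul, map_inv, hkM, hMg]
      exact mul_inv_cancel _
    exact (Subgroup.mul_mem_cancel_right _ (inv_mem hk)).1 hgk
  · rintro g (hg | ⟨t, ht, hgt⟩)
    · exact IA_le_IAm Γ m hg
    · change (g : MulAut (Raag Γ)) ∈ IAm Γ m
      rw [hgt]
      exact pow_mem_IAm ht m

end RaagPaper
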